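/- arXiv:1205.6395 — 2 statements merged into one kernel-verified Lean document; each statement's English description precedes it below -/
import Mathlib

section
/- For every integer v ≥ 64 with v ≡ 4 (mod 12), there exists a 2-(v,4,1) directed design (which has v(v−1)/6 blocks) whose smallest defining sets contain at least (5/8 − 1/(2v))·(v(v−1)/6) blocks. -/
open scoped Classical

/-- A block of size `k` on the point set `α`: a list of `k` distinct points. -/
def IsBlock {α : Type*} (k : ℕ) (b : List α) : Prop :=
  b.Nodup ∧ b.length = k

/-- A `t-(v,k,λ)` directed design whose point set is the whole (finite) type `α`
(so `v = Fintype.card α`): every ordered `t`-tuple of distinct points appears,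
as a subsequence, in exactly `lam` blocks of the multiset `B`. -/
def IsDD {α : Type*} (t k lam : ℕ) (B : Multiset (List α)) : Prop :=
  (∀ b ∈ B, IsBlock k b) ∧
    ∀ s : List α, s.Nodup → s.length = t →
      B.countP (fun b => s.Sublist b) = lam

/-- `S` is a defining set of the `t-(v,k,λ)` directed design with block multiset `B`:
`S` is a sub-multiset of `B`, and `B` is the unique block multiset of a
`t-(v,k,λ)DD` on the same point set containing `S`. -/
def IsDefiningSet {α : Type*} (t k lam : ℕ) (B S : Multiset (List α)) : Prop :=
  S ≤ B ∧ ∀ B' : Multiset (List α), IsDD t k lam B' → S ≤ B' → B' = B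

/-- A `(v,k,t)` directed trade `T₁ - T₂` of volume `s` on the point set `α`. -/
def IsTrade {α : Type*} (t k s : ℕ) (T₁ T₂ : Multiset (List α)) : Prop :=
  1 ≤ s ∧ Multiset.card T₁ = s ∧ Multiset.card T₂ = s ∧
    (∀ b ∈ T₁, IsBlock k b) ∧ (∀ b ∈ T₂, IsBlock k b) ∧
    (∀ b, b ∈ T₁ → b ∉ T₂) ∧
    ∀ l : List α, l.Nodup → l.length = t →
      T₁.countP (fun b => l.Sublist b) = T₂.countP (fun b => l.Sublist b)

/-- A multiset of blocks is super-simple if any two blocks (any sub-multiset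
consisting of two blocks) intersect, as point sets, in at most two points. -/
def SuperSimple {α : Type*} (B : Multiset (List α)) : Prop :=
  ∀ b₁ b₂ : List α, ({b₁, b₂} : Multiset (List α)) ≤ B →
    (b₁.toFinset ∩ b₂.toFinset).card ≤ 2

/-- A `2-(v,K,1)` design (pairwise balanced design) on the point type `β`. -/
def IsPBD {β : Type*} (K : Set ℕ) (D : Multiset (Finset β)) : Prop :=
  (∀ b ∈ D, b.card ∈ K) ∧
    ∀ x y : β, x ≠ y → D.countP (fun b => x ∈ b ∧ y ∈ b) = 1

/-- A `{K}`-GDD on the point type `β` with group multiset `Gs` and block multiset `Bs`. -/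
def IsGDD {β : Type*} (K : Set ℕ) (Gs Bs : Multiset (Finset β)) : Prop :=
  (∀ x : β, Gs.countP (fun G => x ∈ G) = 1) ∧
    (∀ b ∈ Bs, b.card ∈ K) ∧
    (∀ b ∈ Bs, ∀ G ∈ Gs, (b ∩ G).card ≤ 1) ∧
    (∀ x y : β, x ≠ y → (∀ G ∈ Gs, ¬(x ∈ G ∧ y ∈ G)) →
      Bs.countP (fun b => x ∈ b ∧ y ∈ b) = 1)

/-- A `4`-DGDD on the point type `β` with group multiset `Gs` and block multiset `B`:
the groups partition the points, no block meets a group twice, and every ordered pair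
of points from distinct groups appears in exactly one block. -/
def IsDGDD {β : Type*} (Gs : Multiset (Finset β)) (B : Multiset (List β)) : Prop :=
  (∀ x : β, Gs.countP (fun G => x ∈ G) = 1) ∧
    (∀ b ∈ B, IsBlock 4 b) ∧
    (∀ b ∈ B, ∀ G ∈ Gs, (b.toFinset ∩ G).card ≤ 1) ∧
    (∀ x y : β, x ≠ y → (∀ G ∈ Gs, ¬(x ∈ G ∧ y ∈ G)) →
      B.countP (fun b => [x, y].Sublist b) = 1)

/-- `S` is a defining set of the `4`-DGDD with groups `Gs` and block multiset `B`. -/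
def IsDGDDDefiningSet {β : Type*} (Gs : Multiset (Finset β)) (B S : Multiset (List β)) : Prop :=
  S ≤ B ∧ ∀ B' : Multiset (List β), IsDGDD Gs B' → S ≤ B' → B' = B

/-- The number of blocks of `B` in which the ordered pair `(x, y)` appears. -/
noncomputable def cov {α : Type*} (B : Multiset (List α)) (x y : α) : ℕ :=
  B.countP (fun b => [x, y].Sublist b)

/-- Every sub-multiset of `B` with fewer than `h` blocks is contained in another multiset of
blocks covering the same ordered pairs as `B`. -/
def HitBound {α : Type*} (B : Multiset (List α)) (h : ℚ) : Prop :=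
  ∀ S ≤ B, (Multiset.card S : ℚ) < h →
    ∃ B' : Multiset (List α), (∀ b ∈ B', IsBlock 4 b) ∧
      (∀ x y, cov B' x y = cov B x y) ∧ S ≤ B' ∧ B' ≠ B

/-- The ordered pairs in `E` can be decomposed into blocks of size four such that any set of
blocks forcing the decomposition contains at least the proportion `ρ` of all blocks. -/
def Decomposable {α : Type*} (ρ : ℚ) (E : α → α → Prop) : Prop :=
  ∃ B : Multiset (List α), (∀ b ∈ B, IsBlock 4 b) ∧
    (∀ x y, cov B x y = if E x y then 1 else 0) ∧ HitBound B (ρ * Multiset.card B)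

section Cov

variable {α β : Type*}

@[simp] lemma cov_zero (x y : α) : cov 0 x y = 0 := by simp [cov]

lemma cov_add (B C : Multiset (List α)) (x y : α) :
    cov (B + C) x y = cov B x y + cov C x y := by simp [cov]

lemma cov_singleton (b : List α) (x y : α) :
    cov {b} x y = if [x, y].Sublist b then 1 else 0 := by
  rw [cov, Multiset.countP_eq_card_filter, Multiset.filter_singleton]
  split_ifs <;> simp

lemma cov_sum {ι : Type*} (s : Finset ι) (B : ι → Multiset (List α)) (x y : α) :
    cov (∑ i ∈ s, B i) x y = ∑ i ∈ s, cov (B i) x y := by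
  induction s using Finset.induction_on with
  | empty => simp
  | insert a s ha ih => rw [Finset.sum_insert ha, Finset.sum_insert ha, cov_add, ih]

lemma pair_sublist_map_iff {f : α → β} (hf : f.Injective) (p q : α) (b : List α) :
    [f p, f q].Sublist (b.map f) ↔ [p, q].Sublist b := by
  constructor
  · intro h
    obtain ⟨l, hl, e⟩ := List.sublist_map_iff.1 h
    have : [p, q] = l := (List.map_injective_iff.2 hf) (by simpa using e)
    rwa [this]
  · intro h
    simpa using h.map f

lemma cov_map_apply {f : α → β} (hf : f.Injective) (B : Multiset (List α)) (p q : α) :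
    cov (B.map (List.map f)) (f p) (f q) = cov B p q := by
  rw [cov, Multiset.countP_map]
  simp only [pair_sublist_map_iff hf, cov, Multiset.countP_eq_card_filter]

lemma cov_map_eq_zero {f : α → β} (B : Multiset (List α)) (x y : β)
    (h : ¬ ∃ p q, f p = x ∧ f q = y) : cov (B.map (List.map f)) x y = 0 := by
  rw [cov, Multiset.countP_eq_zero]
  intro b hb hs
  obtain ⟨b, -, rfl⟩ := Multiset.mem_map.1 hb
  obtain ⟨l, hl, e⟩ := List.sublist_map_iff.1 hs
  match l, e with
  | [p, q], e =>
    simp only [List.map_cons, List.map_nil, List.cons.injEq, and_true] at e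
    exact h ⟨p, q, e.1.symm, e.2.symm⟩

lemma IsBlock.map {k : ℕ} {f : α → β} (hf : f.Injective) {b : List α} (h : IsBlock k b) :
    IsBlock k (b.map f) := ⟨h.1.map hf, by simpa using h.2⟩

end Cov

section HitBound

variable {α β : Type*}

lemma HitBound.add {B C : Multiset (List α)} {h k : ℚ} (hB : ∀ b ∈ B, IsBlock 4 b)
    (hC : ∀ b ∈ C, IsBlock 4 b) (h₁ : HitBound B h) (h₂ : HitBound C k) :
    HitBound (B + C) (h + k) := by
  intro S hS hcard
  have hsplit : S - B + S ∩ B = S := Multiset.sub_add_inter S B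
  have hle : S - B ≤ C := by rw [tsub_le_iff_left]; exact hS
  have hle' : S ∩ B ≤ B := Multiset.inter_le_right
  have hc : (Multiset.card (S - B) : ℚ) + Multiset.card (S ∩ B) = Multiset.card S := by
    rw [← Nat.cast_add, ← Multiset.card_add, hsplit]
  rcases lt_or_ge (Multiset.card (S ∩ B) : ℚ) h with hlt | hge
  · obtain ⟨B', hb, hcov, hs, hne⟩ := h₁ _ hle' hlt
    refine ⟨B' + C, ?_, ?_, ?_, ?_⟩
    · intro b hb'
      rcases Multiset.mem_add.1 hb' with h' | h'
      exacts [hb b h', hC b h']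
    · intro x y
      rw [cov_add, cov_add, hcov]
    · rw [← hsplit, add_comm]
      exact add_le_add hs hle
    · simpa using hne
  · obtain ⟨C', hb, hcov, hs, hne⟩ := h₂ _ hle (by linarith)
    refine ⟨B + C', ?_, ?_, ?_, ?_⟩
    · intro b hb'
      rcases Multiset.mem_add.1 hb' with h' | h'
      exacts [hB b h', hb b h']
    · intro x y
      rw [cov_add, cov_add, hcov]
    · rw [← hsplit, add_comm]
      exact add_le_add hle' hs
    · simpa using hne

lemma HitBound.zero : HitBound (0 : Multiset (List α)) 0 := by
  intro S _ h
  exact absurd h (by simp)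

lemma HitBound.sum {ι : Type*} (s : Finset ι) {B : ι → Multiset (List α)} {h : ι → ℚ}
    (hB : ∀ i ∈ s, ∀ b ∈ B i, IsBlock 4 b) (hh : ∀ i ∈ s, HitBound (B i) (h i)) :
    HitBound (∑ i ∈ s, B i) (∑ i ∈ s, h i) := by
  induction s using Finset.induction_on with
  | empty => simpa using HitBound.zero
  | insert a s ha ih =>
    rw [Finset.sum_insert ha, Finset.sum_insert ha]
    refine HitBound.add (hB a (by simp)) ?_ (hh a (by simp))
      (ih (fun i hi => hB i (by simp [hi])) fun i hi => hh i (by simp [hi]))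
    intro b hb
    obtain ⟨i, hi, hb⟩ := Multiset.mem_sum.1 hb
    exact hB i (by simp [hi]) b hb

lemma HitBound.map {B : Multiset (List α)} {h : ℚ} (hB : HitBound B h) {f : α → β}
    (hf : f.Injective) : HitBound (B.map (List.map f)) h := by
  have hF : (List.map f).Injective := List.map_injective_iff.2 hf
  intro S hS hcard
  obtain ⟨S, rfl⟩ : ∃ S₀, S = Multiset.map (List.map f) S₀ := by
    refine ⟨S.map (Function.invFun (List.map f)), ?_⟩
    rw [Multiset.map_map]
    conv_lhs => rw [← Multiset.map_id S]
    refine Multiset.map_congr rfl fun x hx => ?_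
    obtain ⟨b, -, rfl⟩ := Multiset.mem_map.1 (Multiset.mem_of_le hS hx)
    simp [Function.leftInverse_invFun hF b]
  obtain ⟨B', hb, hcov, hs, hne⟩ :=
    hB S ((Multiset.map_le_map_iff hF).1 hS) (by simpa using hcard)
  refine ⟨B'.map (List.map f), ?_, ?_, Multiset.map_le_map hs,
    fun e => hne (Multiset.map_injective hF e)⟩
  · intro b hb'
    obtain ⟨b, h', rfl⟩ := Multiset.mem_map.1 hb'
    exact (hb b h').map hf
  · intro x y
    by_cases hxy : ∃ p q, f p = x ∧ f q = y
    · obtain ⟨p, q, rfl, rfl⟩ := hxy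
      rw [cov_map_apply hf, cov_map_apply hf, hcov]
    · rw [cov_map_eq_zero _ _ _ hxy, cov_map_eq_zero _ _ _ hxy]

/-- Glueing decompositions along an exact partition of the ordered pairs. -/
lemma Decomposable.glue {ι : Type*} [Fintype ι] {ρ : ℚ} {W : ι → Type*} {V : Type*}
    (f : ∀ i, W i → V) (hf : ∀ i, (f i).Injective) {E : ∀ i, W i → W i → Prop}
    (hE : ∀ i, Decomposable ρ (E i)) {F : V → V → Prop}
    (hsub : ∀ i p q, E i p q → F (f i p) (f i q))
    (huniq : ∀ x y, F x y → ∃! i, ∃ p q, f i p = x ∧ f i q = y ∧ E i p q) :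
    Decomposable ρ F := by
  choose B hB hcov hhit using hE
  have hblk : ∀ i, ∀ b ∈ (B i).map (List.map (f i)), IsBlock 4 b := by
    intro i b hb
    obtain ⟨b, h', rfl⟩ := Multiset.mem_map.1 hb
    exact (hB i b h').map (hf i)
  have hone : ∀ i x y, cov ((B i).map (List.map (f i))) x y =
      if ∃ p q, f i p = x ∧ f i q = y ∧ E i p q then 1 else 0 := by
    intro i x y
    by_cases hxy : ∃ p q, f i p = x ∧ f i q = y
    · obtain ⟨p, q, rfl, rfl⟩ := hxy
      rw [cov_map_apply (hf i), hcov]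
      refine if_congr ⟨fun h => ⟨p, q, rfl, rfl, h⟩, ?_⟩ rfl rfl
      rintro ⟨p', q', hp, hq, h⟩
      rwa [hf i hp, hf i hq] at h
    · rw [cov_map_eq_zero _ _ _ hxy, if_neg]
      rintro ⟨p, q, hp, hq, -⟩
      exact hxy ⟨p, q, hp, hq⟩
  refine ⟨∑ i, (B i).map (List.map (f i)), ?_, ?_, ?_⟩
  · intro b hb
    obtain ⟨i, -, hb⟩ := Multiset.mem_sum.1 hb
    exact hblk i b hb
  · intro x y
    rw [cov_sum]
    simp only [hone]
    by_cases hxy : F x y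
    · obtain ⟨i, hi, hu⟩ := huniq x y hxy
      rw [if_pos hxy, Finset.sum_eq_single i, if_pos hi]
      · intro j _ hj
        exact if_neg fun h => hj (hu j h)
      · simp
    · rw [if_neg hxy]
      refine Finset.sum_eq_zero fun i _ => if_neg ?_
      rintro ⟨p, q, rfl, rfl, h⟩
      exact hxy (hsub i p q h)
  · have := HitBound.sum Finset.univ (fun i _ => hblk i) fun i _ => (hhit i).map (hf i)
    simpa [Finset.mul_sum] using this

end HitBound

section Swap

variable {α : Type*}

lemma pair_sublist_swap_iff {x y : α} {l r : List α} (h : (l ++ x :: y :: r).Nodup) (p q : α) :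
    [p, q].Sublist (l ++ x :: y :: r) ↔
      (p = x ∧ q = y) ∨ ([p, q].Sublist (l ++ y :: x :: r) ∧ ¬(p = y ∧ q = x)) := by
  induction l with
  | nil =>
    simp only [List.nil_append, List.nodup_cons, List.mem_cons, not_or] at h
    simp only [List.nil_append, List.sublist_cons_iff]
    grind
  | cons a l ih =>
    rw [List.cons_append, List.nodup_cons] at h
    have := ih h.2
    have hmem : ∀ z, z ∈ l ++ x :: y :: r ↔ z ∈ l ++ y :: x :: r := by
      intro z; simp only [List.mem_append, List.mem_cons]; tauto
    have hx : x ∈ l ++ x :: y :: r := by simp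
    have hy : y ∈ l ++ x :: y :: r := by simp
    simp only [List.cons_append, List.cons_sublist_cons', List.singleton_sublist]
    rw [this, hmem]
    have : a ≠ x := fun e => h.1 (e ▸ hx)
    have : a ≠ y := fun e => h.1 (e ▸ hy)
    grind

/-- Two blocks such that some ordered pair is adjacent in one of them and its reversal is
adjacent in the other one. -/
def Swappable (b b' : List α) : Prop := ∃ p ∈ b.zip b.tail, p.swap ∈ b'.zip b'.tail

lemma mem_zip_tail {x y : α} {b : List α} (h : (x, y) ∈ b.zip b.tail) :
    ∃ l r, b = l ++ x :: y :: r := by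
  induction b with
  | nil => simp at h
  | cons a b ih =>
    cases b with
    | nil => simp at h
    | cons c b =>
      simp only [List.tail_cons, List.zip_cons_cons, List.mem_cons, Prod.mk.injEq] at h ih
      rcases h with ⟨rfl, rfl⟩ | h
      · exact ⟨[], b, rfl⟩
      · obtain ⟨l, r, e⟩ := ih h
        exact ⟨a :: l, r, by rw [e]; rfl⟩

/-- Two blocks without a common ordered pair. -/
def PairDisjoint (b b' : List α) : Prop :=
  ∀ x y, [x, y].Sublist b → ¬ [x, y].Sublist b'

lemma Swappable.exists_ne {b b' : List α} (h : Swappable b b') (hb : IsBlock 4 b)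
    (hb' : IsBlock 4 b') (hd : PairDisjoint b b') :
    ∃ C : Multiset (List α), (∀ c ∈ C, IsBlock 4 c) ∧
      (∀ x y, cov C x y = cov ({b} + {b'}) x y) ∧ C ≠ {b} + {b'} := by
  obtain ⟨⟨x, y⟩, h₁, h₂⟩ := h
  obtain ⟨l, r, rfl⟩ := mem_zip_tail h₁
  obtain ⟨l', r', rfl⟩ := mem_zip_tail h₂
  have hp : ∀ (x y : α) (l r : List α), (l ++ y :: x :: r).Perm (l ++ x :: y :: r) :=
    fun x y l r => (List.Perm.swap x y r).append_left l
  have hc : IsBlock 4 (l ++ y :: x :: r) :=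
    ⟨(hp x y l r).nodup_iff.2 hb.1, by simpa using hb.2⟩
  have hc' : IsBlock 4 (l' ++ x :: y :: r') :=
    ⟨(hp y x l' r').nodup_iff.2 hb'.1, by simpa using hb'.2⟩
  have hxy : x ≠ y := by
    have := hb.1; grind
  refine ⟨{l ++ y :: x :: r} + {l' ++ x :: y :: r'}, ?_, ?_, ?_⟩
  · intro c hc''
    simp only [Multiset.mem_add, Multiset.mem_singleton] at hc''
    rcases hc'' with rfl | rfl <;> assumption
  · intro p q
    have e₁ := pair_sublist_swap_iff hb.1 p q
    have e₂ := pair_sublist_swap_iff hc.1 p q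
    have e₃ := pair_sublist_swap_iff hb'.1 p q
    have e₄ := pair_sublist_swap_iff hc'.1 p q
    simp only [cov_add, cov_singleton]
    grind
  · intro e
    have hmem : l ++ y :: x :: r ∈ ({l ++ x :: y :: r} + {l' ++ y :: x :: r'} :
        Multiset (List α)) := by rw [← e]; simp
    simp only [Multiset.mem_add, Multiset.mem_singleton] at hmem
    rcases hmem with e | e
    · simp [hxy.symm] at e
    · have key : ∀ p q, ¬ (p = y ∧ q = x) → ¬ [p, q].Sublist (l ++ y :: x :: r) := by
        intro p q hpq hs
        exact hd p q ((pair_sublist_swap_iff hb.1 p q).2 (Or.inr ⟨hs, hpq⟩)) (e ▸ hs)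
      obtain ⟨a, b, c, d, habcd⟩ : ∃ a b c d, l ++ y :: x :: r = [a, b, c, d] :=
        List.length_eq_four.1 hc.2
      have hn := hc.1
      rw [habcd] at key hn
      have k₁ := key a b
      have k₂ := key c d
      simp at hn
      have : [c, d].Sublist [a, b, c, d] := (List.sublist_append_right [a, b] [c, d])
      have : [a, b].Sublist [a, b, c, d] := (List.sublist_append_left [a, b] [c, d])
      grind

end Swap

section Triangle

variable {α : Type*}

/-- Three blocks, pairwise without common ordered pairs, any two of which can be traded. -/
structure IsTriangle (b₁ b₂ b₃ : List α) : Prop where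
  block₁ : IsBlock 4 b₁
  block₂ : IsBlock 4 b₂
  block₃ : IsBlock 4 b₃
  disj₁₂ : PairDisjoint b₁ b₂
  disj₁₃ : PairDisjoint b₁ b₃
  disj₂₃ : PairDisjoint b₂ b₃
  swap₁₂ : Swappable b₁ b₂
  swap₁₃ : Swappable b₁ b₃
  swap₂₃ : Swappable b₂ b₃

lemma IsTriangle.hitBound {b₁ b₂ b₃ : List α} (h : IsTriangle b₁ b₂ b₃) :
    HitBound ({b₁} + ({b₂} + {b₃})) 2 := by
  intro S hS hcard
  have hcard : Multiset.card S < 2 := by exact_mod_cast hcard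
  have key : ∀ a b c : List α, IsBlock 4 a → IsBlock 4 b → IsBlock 4 c → PairDisjoint b c →
      Swappable b c → S ≤ {a} → ({a} + ({b} + {c}) : Multiset (List α)) = {b₁} + ({b₂} + {b₃}) →
      ∃ B' : Multiset (List α), (∀ b ∈ B', IsBlock 4 b) ∧
      (∀ x y, cov B' x y = cov ({b₁} + ({b₂} + {b₃})) x y) ∧ S ≤ B' ∧
        B' ≠ {b₁} + ({b₂} + {b₃}) := by
    intro a b c ha hb hc hd hs hle e
    obtain ⟨C, hC, hcov, hne⟩ := hs.exists_ne hb hc hd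
    refine ⟨{a} + C, ?_, ?_, hle.trans (Multiset.le_add_right _ _), ?_⟩
    · intro x hx
      rcases Multiset.mem_add.1 hx with hx | hx
      · rw [Multiset.mem_singleton.1 hx]; exact ha
      · exact hC x hx
    · intro x y
      rw [← e, cov_add, cov_add, hcov]
    · rw [← e]
      exact fun h => hne (add_left_cancel h)
  have k₁ := key b₁ b₂ b₃ h.block₁ h.block₂ h.block₃ h.disj₂₃ h.swap₂₃
  have k₂ := key b₂ b₁ b₃ h.block₂ h.block₁ h.block₃ h.disj₁₃ h.swap₁₃
  have k₃ := key b₃ b₁ b₂ h.block₃ h.block₁ h.block₂ h.disj₁₂ h.swap₁₂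
  interval_cases hk : Multiset.card S
  · rw [Multiset.card_eq_zero] at hk
    subst hk
    exact k₁ (Multiset.zero_le _) rfl
  · obtain ⟨s, rfl⟩ := Multiset.card_eq_one.1 hk
    have hs := Multiset.subset_of_le hS (Multiset.mem_singleton_self s)
    simp only [Multiset.mem_add, Multiset.mem_singleton] at hs
    rcases hs with rfl | rfl | rfl
    · exact k₁ le_rfl rfl
    · exact k₂ le_rfl (by abel)
    · exact k₃ le_rfl (by abel)

lemma HitBound.mono {B : Multiset (List α)} {h k : ℚ} (hB : HitBound B h) (hk : k ≤ h) :
    HitBound B k := fun S hS hc => hB S hS (hc.trans_le hk)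

lemma IsTriangle.decomposable {b₁ b₂ b₃ : List α} (h : IsTriangle b₁ b₂ b₃) :
    Decomposable (5 / 8) fun x y =>
      [x, y].Sublist b₁ ∨ [x, y].Sublist b₂ ∨ [x, y].Sublist b₃ := by
  refine ⟨{b₁} + ({b₂} + {b₃}), ?_, ?_, ?_⟩
  · intro b hb
    simp only [Multiset.mem_add, Multiset.mem_singleton] at hb
    rcases hb with rfl | rfl | rfl
    exacts [h.block₁, h.block₂, h.block₃]
  · intro x y
    have := h.disj₁₂ x y
    have := h.disj₁₃ x y
    have := h.disj₂₃ x y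
    simp only [cov_add, cov_singleton]
    grind
  · exact h.hitBound.mono (by norm_num)

end Triangle

section Fillable

/-- The ordered pairs of points of `X × Fin 3` with distinct first coordinates can be decomposed
into blocks of size four such that at least five eighths of the blocks are needed to force the
decomposition. -/
def Fillable (X : Type) : Prop := Decomposable (5 / 8) fun p q : X × Fin 3 => p.1 ≠ q.1

lemma Fillable.of_equiv {X Y : Type} (e : X ≃ Y) (h : Fillable X) : Fillable Y := by
  refine Decomposable.glue (ι := Unit) (fun _ => Prod.map e id)
    (fun _ => e.injective.prodMap Function.injective_id) (fun _ => h) ?_ ?_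
  · intro _ p q hpq
    simpa using hpq
  · intro x y hxy
    refine ⟨(), ⟨(e.symm x.1, x.2), (e.symm y.1, y.2), ?_, ?_, ?_⟩, by simp⟩ <;> simp_all

lemma Fillable.of_subsingleton {X : Type} [Subsingleton X] : Fillable X := by
  refine ⟨0, by simp, ?_, by simpa using HitBound.zero⟩
  intro x y
  simp [Subsingleton.elim x.1 y.1]

instance {α : Type} [DecidableEq α] (b b' : List α) : Decidable (Swappable b b') :=
  inferInstanceAs (Decidable (∃ p ∈ b.zip b.tail, p.swap ∈ b'.zip b'.tail))

lemma Fillable.of_triangles {X ι : Type} [Fintype ι] (T : ι → Fin 3 → List (X × Fin 3))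
    (hT : ∀ i k, ((T i k).map Prod.fst).Nodup ∧ (T i k).length = 4)
    (hswap : ∀ i, Swappable (T i 0) (T i 1) ∧ Swappable (T i 0) (T i 2) ∧
      Swappable (T i 1) (T i 2))
    (huniq : ∀ x y : X × Fin 3, x.1 ≠ y.1 → ∃ p : ι × Fin 3, [x, y].Sublist (T p.1 p.2) ∧
      ∀ p' : ι × Fin 3, [x, y].Sublist (T p'.1 p'.2) → p' = p) :
    Fillable X := by
  have hblk : ∀ i k, IsBlock 4 (T i k) := fun i k => ⟨(hT i k).1.of_map _, (hT i k).2⟩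
  have hne : ∀ i k x y, [x, y].Sublist (T i k) → x.1 ≠ y.1 := by
    intro i k x y h
    simpa using (hT i k).1.sublist (h.map Prod.fst)
  have hdisj : ∀ i k k', k ≠ k' → PairDisjoint (T i k) (T i k') := by
    intro i k k' hk x y h h'
    have := ExistsUnique.unique (huniq x y (hne _ _ _ _ h)) (y₁ := (i, k)) (y₂ := (i, k')) h h'
    exact hk (Prod.ext_iff.1 this).2
  have htri : ∀ i, IsTriangle (T i 0) (T i 1) (T i 2) := fun i =>
    ⟨hblk _ _, hblk _ _, hblk _ _, hdisj _ _ _ (by decide), hdisj _ _ _ (by decide),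
      hdisj _ _ _ (by decide), (hswap i).1, (hswap i).2.1, (hswap i).2.2⟩
  refine Decomposable.glue (fun _ => id) (fun _ => Function.injective_id)
    (fun i => (htri i).decomposable) ?_ ?_
  · rintro i p q (h | h | h) <;> exact hne _ _ _ _ h
  · intro x y hxy
    obtain ⟨⟨i, k⟩, h, hu⟩ := huniq x y hxy
    refine ⟨i, ⟨x, y, rfl, rfl, ?_⟩, ?_⟩
    · fin_cases k
      exacts [Or.inl h, Or.inr (Or.inl h), Or.inr (Or.inr h)]
    · rintro j ⟨p, q, rfl, rfl, h | h | h⟩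
      exacts [congrArg Prod.fst (hu (j, 0) h), congrArg Prod.fst (hu (j, 1) h),
        congrArg Prod.fst (hu (j, 2) h)]

lemma fillable_four : Fillable (Fin 4) := by
  refine Fillable.of_triangles (ι := Fin 6) ![
    ![[(3,1),(1,0),(0,0),(2,0)], [(2,1),(3,0),(0,0),(1,0)], [(2,0),(0,0),(3,0),(1,1)]],
    ![[(1,2),(0,0),(3,2),(2,1)], [(2,2),(0,0),(1,2),(3,1)], [(1,1),(3,2),(0,0),(2,2)]],
    ![[(1,1),(0,1),(3,1),(2,1)], [(2,2),(0,1),(1,1),(3,0)], [(1,0),(3,1),(0,1),(2,2)]],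
    ![[(3,2),(1,1),(0,2),(2,0)], [(2,1),(3,1),(0,2),(1,1)], [(2,0),(0,2),(3,1),(1,2)]],
    ![[(3,0),(1,2),(0,1),(2,0)], [(2,1),(3,2),(0,1),(1,2)], [(2,0),(0,1),(3,2),(1,0)]],
    ![[(1,0),(0,2),(3,0),(2,1)], [(2,2),(0,2),(1,0),(3,2)], [(1,2),(3,0),(0,2),(2,2)]]]
    ?_ ?_ ?_
  · decide +kernel
  · decide +kernel
  · decide +kernel

lemma fillable_five : Fillable (ZMod 5) := by
  refine Fillable.of_triangles (ι := ZMod 5 × Fin 2) (fun i k =>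
    ((![
      ![[(3,1),(2,0),(1,0),(0,1)], [(0,2),(2,0),(3,1),(4,1)], [(1,0),(2,0),(0,2),(4,0)]],
      ![[(4,1),(0,2),(1,2),(2,1)], [(3,1),(2,1),(1,2),(4,0)], [(3,2),(4,0),(1,2),(0,2)]]] :
      Fin 2 → Fin 3 → List (ZMod 5 × Fin 3)) i.2 k).map fun x => (x.1 + i.1, x.2)) ?_ ?_ ?_
  · decide +kernel
  · decide +kernel
  · decide +kernel

set_option synthInstance.maxSize 1000 in
lemma fillable_seven : Fillable (ZMod 7) := by
  refine Fillable.of_triangles (ι := ZMod 7 × Fin 3) (fun i k =>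
    ((![[(3,1),(6,0),(5,1),(4,0)], [(2,1),(0,0),(4,0),(5,1)], [(0,0),(2,1),(6,0),(3,1)]] :
      Fin 3 → List (ZMod 7 × Fin 3)) k).map fun x => (x.1 + i.1, x.2 + i.2)) ?_ ?_ ?_
  · decide +kernel
  · decide +kernel
  · decide +kernel

end Fillable

section Closure

lemma Fillable.of_card {X : Type} [Fintype X] {n : ℕ} (h : Fillable (Fin n))
    (hX : Fintype.card X = n) : Fillable X :=
  h.of_equiv (Fintype.equivFinOfCardEq hX).symm

lemma Fillable.fin_card {X : Type} [Fintype X] (h : Fillable X) :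
    Fillable (Fin (Fintype.card X)) :=
  h.of_equiv (Fintype.equivFin X)

lemma Fillable.of_pbd {X J : Type} [Fintype J] (S : J → Finset X)
    (hS : ∀ j, Fillable (Fin (S j).card))
    (huniq : ∀ x y, x ≠ y → ∃! j, x ∈ S j ∧ y ∈ S j) : Fillable X := by
  refine Decomposable.glue (W := fun j => S j × Fin 3) (fun j => Prod.map Subtype.val id)
    (fun j => Subtype.val_injective.prodMap Function.injective_id)
    (fun j => (hS j).of_card (X := S j) (by simp)) ?_ ?_
  · intro j p q hpq
    exact fun e => hpq (Subtype.ext e)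
  · intro x y hxy
    obtain ⟨j, ⟨hx, hy⟩, hu⟩ := huniq x.1 y.1 hxy
    refine ⟨j, ⟨(⟨x.1, hx⟩, x.2), (⟨y.1, hy⟩, y.2), rfl, rfl, by simpa using hxy⟩, ?_⟩
    rintro k ⟨p, q, rfl, rfl, -⟩
    exact hu k ⟨p.1.2, q.1.2⟩

/-- Filling a truncated transversal design with five groups: four groups are copies of `R`,
the fifth one is `T`. -/
lemma Fillable.of_transversal {R : Type} [CommRing R] [Fintype R] (s : Fin 4 → R)
    (hs : ∀ i j, i ≠ j → IsUnit (s i - s j)) (T : Finset R) (h₄ : Fillable (Fin 4))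
    (h₅ : Fillable (Fin 5)) (hR : Fillable (Fin (Fintype.card R))) (hT : Fillable (Fin T.card)) :
    Fillable ((Fin 4 × R) ⊕ T) := by
  have hinj : ∀ p : R × R, Function.Injective fun i : Fin 4 => (i, p.1 + s i * p.2) :=
    fun p i j h => (Prod.ext_iff.1 h).1
  refine Fillable.of_pbd (J := (R × R) ⊕ Option (Fin 4)) (fun j => match j with
    | .inl p => (Finset.univ.map ⟨_, hinj p⟩).disjSum (Finset.univ.filter fun t : T => t.1 = p.2)
    | .inr (some i) => (({i} : Finset (Fin 4)) ×ˢ (Finset.univ : Finset R)).disjSum ∅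
    | .inr none => (∅ : Finset (Fin 4 × R)).disjSum Finset.univ) ?_ ?_
  · rintro (p | _ | i)
    · have hle : (Finset.univ.filter fun t : T => t.1 = p.2).card ≤ 1 := by
        rw [Finset.card_le_one]
        intro a ha b hb
        simp only [Finset.mem_filter, Finset.mem_univ, true_and] at ha hb
        exact Subtype.ext (ha.trans hb.symm)
      simp only [Finset.card_disjSum, Finset.card_map, Finset.card_univ, Fintype.card_fin]
      interval_cases (Finset.univ.filter fun t : T => t.1 = p.2).card
      exacts [h₄, h₅]
    · simpa using hT
    · simpa using hR
  · rintro (⟨i, c⟩ | t) (⟨i', c'⟩ | t') hne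
    · by_cases hi : i = i'
      · subst hi
        refine ⟨.inr (some i), by simp, ?_⟩
        rintro (⟨a, b⟩ | _ | k) h
        · simp at h
          exact absurd (by rw [← h.1, h.2]) hne
        · simp at h
        · simp at h
          rw [h]
      · obtain ⟨w, hw⟩ := hs i i' hi
        have hw' : (s i - s i') * ((w⁻¹ : Rˣ) : R) = 1 := by rw [← hw]; simp
        refine ⟨.inl (c - s i * ((c - c') * (w⁻¹ : Rˣ)), (c - c') * (w⁻¹ : Rˣ)), ?_, ?_⟩
        · simp
          linear_combination (c' - c) * hw'
        · rintro (⟨a, b⟩ | _ | k) h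
          · simp at h
            have hb : b = (c - c') * (w⁻¹ : Rˣ) := by
              rw [← h.1, ← h.2]
              linear_combination (-b) * hw'
            rw [← hb, ← h.1]
            simp
          · simp at h
          · simp at h
            exact absurd (h.1.symm.trans h.2) hi
    · refine ⟨.inl (c - s i * t'.1, t'.1), by simp, ?_⟩
      rintro (⟨a, b⟩ | _ | k) h
      · simp at h
        rw [← h.1, h.2]
        simp
      · simp at h
      · simp at h
    · refine ⟨.inl (c' - s i' * t.1, t.1), by simp, ?_⟩
      rintro (⟨a, b⟩ | _ | k) h
      · simp at h
        rw [← h.2, h.1]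
        simp
      · simp at h
      · simp at h
    · refine ⟨.inr none, by simp, ?_⟩
      rintro (⟨a, b⟩ | _ | k) h
      · simp at h
        exact absurd (by rw [Subtype.ext (h.1.trans h.2.symm)]) hne
      · rfl
      · simp at h

/-- Filling the design over `ZMod u` developed from a difference family with blocks of size four
and five. -/
lemma Fillable.of_difference_family (u : ℕ) [NeZero u] {k : ℕ} (D : Fin k → List ℕ)
    (hD : ∀ j, (D j).Nodup ∧ (∀ p ∈ D j, p < u) ∧ ((D j).length = 4 ∨ (D j).length = 5))
    (hex : ∀ d < u, d ≠ 0 → ∃ j, ∃ p ∈ D j, ∃ q ∈ D j, q % u = (p + d) % u)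
    (hcard : ∑ j, (D j).length * ((D j).length - 1) = u - 1)
    (h₄ : Fillable (Fin 4)) (h₅ : Fillable (Fin 5)) : Fillable (Fin u) := by
  have hex' : ∀ d : ZMod u, d ≠ 0 → ∃ j, ∃ p ∈ D j, ∃ q ∈ D j, (q : ZMod u) - p = d := by
    intro d hd
    obtain ⟨j, p, hp, q, hq, h⟩ := hex d.val (ZMod.val_lt d) (by simpa [ZMod.val_eq_zero] using hd)
    have := (ZMod.natCast_eq_natCast_iff' _ _ u).2 h
    exact ⟨j, p, hp, q, hq, by simp [this]⟩
  have hinj : Set.InjOn (fun t : Σ _ : Fin k, ℕ × ℕ => (t.2.2 : ZMod u) - t.2.1)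
      (Finset.univ.sigma fun j => (D j).toFinset.offDiag) := by
    refine Finset.injOn_of_surjOn_of_card_le (t := Finset.univ.erase 0) _ ?_ ?_ ?_
    · rintro ⟨j, p, q⟩ h
      simp only [Finset.coe_sigma, Finset.coe_univ, Set.mem_sigma_iff, Set.mem_univ, true_and,
        Finset.mem_coe, Finset.mem_offDiag, List.mem_toFinset] at h
      simp only [Finset.coe_erase, Finset.coe_univ, Set.mem_sdiff, Set.mem_univ, true_and,
        Set.mem_singleton_iff, sub_eq_zero]
      intro e
      have e := (ZMod.natCast_eq_natCast_iff' q p u).1 e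
      rw [Nat.mod_eq_of_lt ((hD j).2.1 q h.2.1), Nat.mod_eq_of_lt ((hD j).2.1 p h.1)] at e
      exact h.2.2 e.symm
    · intro d hd
      have hd : d ≠ 0 := by simpa using hd
      obtain ⟨j, p, hp, q, hq, h⟩ := hex' d hd
      refine ⟨⟨j, p, q⟩, ?_, h⟩
      have hpq : p ≠ q := by
        rintro rfl
        exact hd (by simp [← h])
      simp [hp, hq, hpq]
    · rw [Finset.card_sigma, Finset.card_erase_of_mem (Finset.mem_univ _), Finset.card_univ,
        ZMod.card, ← hcard]
      refine Finset.sum_le_sum fun j _ => ?_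
      rw [Finset.offDiag_card, List.toFinset_card_of_nodup (hD j).1, Nat.mul_sub_one]
  refine Fillable.of_card (n := u) (X := Fin u) ?_ (by simp)
  rw [← ZMod.card u]
  refine Fillable.fin_card (Fillable.of_pbd (J := ZMod u × Fin k)
    (fun i => (D i.2).toFinset.image fun p : ℕ => (p : ZMod u) + i.1) ?_ ?_)
  · rintro ⟨s, j⟩
    rw [Finset.card_image_of_injOn, List.toFinset_card_of_nodup (hD j).1]
    · rcases (hD j).2.2 with h | h <;> rw [h] <;> assumption
    · intro p hp q hq h
      simp only [List.coe_toFinset, Set.mem_ofPred_eq] at hp hq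
      have h := (ZMod.natCast_eq_natCast_iff' p q u).1 (add_right_cancel h)
      rwa [Nat.mod_eq_of_lt ((hD j).2.1 p hp), Nat.mod_eq_of_lt ((hD j).2.1 q hq)] at h
  · intro x y hxy
    obtain ⟨j, p, hp, q, hq, h⟩ := hex' (y - x) (sub_ne_zero.2 hxy.symm)
    have hpq : p ≠ q := by
      rintro rfl
      exact hxy (by linear_combination h)
    refine ⟨(x - p, j), ⟨?_, ?_⟩, ?_⟩
    · exact Finset.mem_image.2 ⟨p, by simpa using hp, by ring⟩
    · exact Finset.mem_image.2 ⟨q, by simpa using hq, by linear_combination h⟩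
    · rintro ⟨s, j'⟩ ⟨h₁, h₂⟩
      obtain ⟨p', hp', hx⟩ := Finset.mem_image.1 h₁
      obtain ⟨q', hq', hy⟩ := Finset.mem_image.1 h₂
      have hpq' : p' ≠ q' := by
        rintro rfl
        exact hxy (by linear_combination hy - hx)
      have := @hinj ⟨j', p', q'⟩ (by simp_all) ⟨j, p, q⟩ (by simp_all)
        (show (q' : ZMod u) - p' = q - p by linear_combination hy - hx - h)
      obtain ⟨rfl, e⟩ := Sigma.mk.inj_iff.1 this
      obtain ⟨rfl, -⟩ := Prod.mk.inj (eq_of_heq e)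
      have : s = x - p' := by linear_combination hx
      rw [this]

lemma fillable_thirteen : Fillable (Fin 13) :=
  Fillable.of_difference_family 13
    ![[0, 1, 3, 9]]
    (by decide +kernel) (by decide +kernel) (by decide +kernel) fillable_four fillable_five

lemma fillable_twenty_one : Fillable (Fin 21) :=
  Fillable.of_difference_family 21
    ![[0, 1, 4, 14, 16]]
    (by decide +kernel) (by decide +kernel) (by decide +kernel) fillable_four fillable_five

lemma fillable_thirty_seven : Fillable (Fin 37) :=
  Fillable.of_difference_family 37
    ![[0, 1, 21, 24], [0, 2, 28, 33], [0, 7, 15, 25]]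
    (by decide +kernel) (by decide +kernel) (by decide +kernel) fillable_four fillable_five

lemma fillable_forty_one : Fillable (Fin 41) :=
  Fillable.of_difference_family 41
    ![[0, 1, 4, 11, 29], [0, 2, 21, 26, 35]]
    (by decide +kernel) (by decide +kernel) (by decide +kernel) fillable_four fillable_five

lemma fillable_forty_five : Fillable (Fin 45) :=
  Fillable.of_difference_family 45
    ![[0, 1, 3, 12, 19], [0, 4, 25, 39], [0, 5, 13, 28]]
    (by decide +kernel) (by decide +kernel) (by decide +kernel) fillable_four fillable_five

lemma fillable_forty_nine : Fillable (Fin 49) :=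
  Fillable.of_difference_family 49
    ![[0, 1, 11, 42], [0, 2, 5, 19], [0, 4, 27, 33], [0, 9, 21, 34]]
    (by decide +kernel) (by decide +kernel) (by decide +kernel) fillable_four fillable_five

lemma fillable_sixty_one : Fillable (Fin 61) :=
  Fillable.of_difference_family 61
    ![[0, 1, 32, 35, 52], [0, 2, 14, 21, 57], [0, 5, 13, 28, 50]]
    (by decide +kernel) (by decide +kernel) (by decide +kernel) fillable_four fillable_five

lemma fillable_seventy_seven : Fillable (Fin 77) :=
  Fillable.of_difference_family 77
    ![[0, 1, 32, 34, 58], [0, 3, 55, 68, 72], [0, 6, 41, 56], [0, 7, 23, 37], [0, 10, 28, 39]]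
    (by decide +kernel) (by decide +kernel) (by decide +kernel) fillable_four fillable_five

lemma fillable_eighty_nine : Fillable (Fin 89) :=
  Fillable.of_difference_family 89
    ![[0, 1, 58, 69, 83], [0, 2, 46, 55, 63], [0, 3, 42, 79], [0, 4, 19, 60], [0, 5, 59, 71],
      [0, 16, 38, 65]]
    (by decide +kernel) (by decide +kernel) (by decide +kernel) fillable_four fillable_five

lemma fillable_ninety_three : Fillable (Fin 93) :=
  Fillable.of_difference_family 93
    ![[0, 1, 18, 81, 83], [0, 3, 7, 52, 61], [0, 5, 19, 34, 55], [0, 6, 22, 46, 73],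
      [0, 8, 31, 68]]
    (by decide +kernel) (by decide +kernel) (by decide +kernel) fillable_four fillable_five

lemma fillable_ninety_seven : Fillable (Fin 97) :=
  Fillable.of_difference_family 97
    ![[0, 1, 57, 82], [0, 2, 26, 87], [0, 3, 55, 62], [0, 4, 64, 70], [0, 5, 49, 83],
      [0, 8, 28, 51], [0, 9, 22, 39], [0, 11, 29, 76]]
    (by decide +kernel) (by decide +kernel) (by decide +kernel) fillable_four fillable_five

lemma fillable_one_hundred_nine : Fillable (Fin 109) :=
  Fillable.of_difference_family 109
    ![[0, 1, 35, 64], [0, 2, 5, 49], [0, 4, 70, 93], [0, 6, 67, 77], [0, 7, 85, 98],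
      [0, 8, 25, 58], [0, 9, 36, 88], [0, 12, 26, 81], [0, 15, 68, 87]]
    (by decide +kernel) (by decide +kernel) (by decide +kernel) fillable_four fillable_five

lemma fillable_one_hundred_fifty_seven : Fillable (Fin 157) :=
  Fillable.of_difference_family 157
    ![[0, 1, 82, 84], [0, 3, 138, 142], [0, 5, 114, 120], [0, 7, 105, 113], [0, 9, 94, 104],
      [0, 11, 36, 144], [0, 12, 38, 58], [0, 14, 41, 69], [0, 16, 86, 117], [0, 17, 67, 96],
      [0, 21, 54, 118], [0, 23, 57, 89], [0, 30, 65, 110]]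
    (by decide +kernel) (by decide +kernel) (by decide +kernel) fillable_four fillable_five

lemma exists_isUnit_sub_of_coprime {m : ℕ} (hm : m.Coprime 6) (i j : Fin 4) (hij : i ≠ j) :
    IsUnit ((i.val : ZMod m) - (j.val : ZMod m)) := by
  have key : ∀ d : ℕ, d ∣ 6 → IsUnit (d : ZMod m) := fun d hd =>
    (ZMod.isUnit_iff_coprime d m).2 (hm.coprime_dvd_right hd).symm
  rcases lt_or_gt_of_ne hij with h | h
  · rw [← neg_sub, IsUnit.neg_iff, ← Nat.cast_sub (le_of_lt h)]
    refine key _ ?_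
    revert i j; decide
  · rw [← Nat.cast_sub (le_of_lt h)]
    refine key _ ?_
    revert i j; decide

lemma Fillable.four_mul_add {m r : ℕ} (hm : m.Coprime 6) (hr : r ≤ m) (hm' : Fillable (Fin m))
    (hr' : Fillable (Fin r)) : Fillable (Fin (4 * m + r)) := by
  have : NeZero m := ⟨by rintro rfl; simp at hm⟩
  obtain ⟨T, -, rfl⟩ := Finset.exists_subset_card_eq (s := (Finset.univ : Finset (ZMod m)))
    (n := r) (by simpa [ZMod.card] using hr)
  have h := Fillable.of_transversal (R := ZMod m) (fun i => (i.val : ZMod m))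
    (exists_isUnit_sub_of_coprime hm) T fillable_four fillable_five (by rwa [ZMod.card]) hr'
  simpa [ZMod.card] using h.fin_card

lemma fillable_seventeen : Fillable (Fin 17) := by
  have : Fintype (GaloisField 2 2) := Fintype.ofFinite _
  have hcard : Fintype.card (GaloisField 2 2) = 4 := by
    rw [← Nat.card_eq_fintype_card, GaloisField.card 2 2 (by norm_num)]; norm_num
  let e := (Fintype.equivFinOfCardEq hcard).symm
  have h := Fillable.of_transversal (R := GaloisField 2 2) e
    (fun i j hij => (sub_ne_zero.2 (e.injective.ne hij)).isUnit) {0} fillable_four fillable_five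
    (by rw [hcard]; exact fillable_four)
    (by rw [Finset.card_singleton]; exact Fillable.of_subsingleton)
  simpa [hcard] using h.fin_card

lemma fillable_twenty_nine : Fillable (Fin 29) :=
  Fillable.four_mul_add (m := 7) (r := 1) (by decide) (by decide) fillable_seven
    Fillable.of_subsingleton

lemma fillable_thirty_three : Fillable (Fin 33) :=
  Fillable.four_mul_add (m := 7) (r := 5) (by decide) (by decide) fillable_seven fillable_five

set_option synthInstance.maxSize 1000 in
lemma exists_four_mul_add {u : ℕ} (hu : u % 4 = 1) (hu' : u ≠ 9) :
    u ∈ [1, 5, 13, 17, 21, 29, 33, 37, 41, 45, 49, 61, 77, 89, 93, 97, 109, 157] ∨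
      ∃ m r, (m % 12 = 1 ∨ m % 12 = 5) ∧ r % 4 = 1 ∧ r ≠ 9 ∧ r ≤ m ∧ u = 4 * m + r := by
  rcases lt_or_ge u 160 with h | h
  · have key : ∀ u < 160, u % 4 = 1 → u ≠ 9 →
        u ∈ [1, 5, 13, 17, 21, 29, 33, 37, 41, 45, 49, 61, 77, 89, 93, 97, 109, 157] ∨
        ∃ m < 40, ∃ r < 40, (m % 12 = 1 ∨ m % 12 = 5) ∧ r % 4 = 1 ∧ r ≠ 9 ∧ r ≤ m ∧
          u = 4 * m + r := by decide +kernel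
    rcases key u h hu hu' with h | ⟨m, -, r, -, h⟩
    exacts [Or.inl h, Or.inr ⟨m, r, h⟩]
  · right
    have hs : u % 48 = 1 ∨ u % 48 = 13 ∨ u % 48 = 29 ∨
        (u % 48 = 5 ∨ u % 48 = 9 ∨ u % 48 = 17 ∨ u % 48 = 21) ∨
        (u % 48 = 25 ∨ u % 48 = 33 ∨ u % 48 = 37 ∨ u % 48 = 41 ∨ u % 48 = 45) := by omega
    rcases hs with hs | hs | hs | hs | hs
    · exact ⟨(u - 29) / 4, 29, by omega, by omega, by omega, by omega, by omega⟩
    · exact ⟨(u - 41) / 4, 41, by omega, by omega, by omega, by omega, by omega⟩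
    · exact ⟨(u - 25) / 4, 25, by omega, by omega, by omega, by omega, by omega⟩
    · exact ⟨(u - (u % 48 - 4)) / 4, u % 48 - 4, by omega, by omega, by omega, by omega, by omega⟩
    · exact ⟨(u - (u % 48 - 20)) / 4, u % 48 - 20, by omega, by omega, by omega, by omega,
        by omega⟩

lemma fillable_of_mod_four (u : ℕ) (hu : u % 4 = 1) (hu' : u ≠ 9) : Fillable (Fin u) := by
  induction u using Nat.strong_induction_on with
  | _ u ih =>
  rcases exists_four_mul_add hu hu' with h | ⟨m, r, hm, hr, hr', hle, rfl⟩
  · simp only [List.mem_cons, List.not_mem_nil, or_false] at h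
    rcases h with rfl | rfl | rfl | rfl | rfl | rfl | rfl | rfl | rfl | rfl | rfl | rfl | rfl |
      rfl | rfl | rfl | rfl | rfl
    exacts [Fillable.of_subsingleton, fillable_five, fillable_thirteen, fillable_seventeen,
      fillable_twenty_one, fillable_twenty_nine, fillable_thirty_three, fillable_thirty_seven,
      fillable_forty_one, fillable_forty_five, fillable_forty_nine, fillable_sixty_one,
      fillable_seventy_seven, fillable_eighty_nine, fillable_ninety_three, fillable_ninety_seven,
      fillable_one_hundred_nine, fillable_one_hundred_fifty_seven]
  · have hcop : m.Coprime 6 := by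
      have : m % 6 = 1 ∨ m % 6 = 5 := by omega
      rw [Nat.coprime_comm, Nat.Coprime, Nat.gcd_rec]
      rcases this with h | h <;> rw [h] <;> rfl
    exact Fillable.four_mul_add hcop hle (ih m (by omega) (by omega) (by omega))
      (ih r (by omega) hr hr')

end Closure

section Fill

/-- The pair of blocks running through four points in opposite directions. -/
lemma decomposable_ne_fin_four : Decomposable (1 / 2) fun x y : Fin 4 => x ≠ y := by
  have hcov : ∀ b b' : List (Fin 4), ∀ x y, cov ({b} + {b'}) x y =
      (if [x, y].Sublist b then 1 else 0) + if [x, y].Sublist b' then 1 else 0 := by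
    intro b b' x y
    rw [cov_add, cov_singleton, cov_singleton]
    congr
  have hblk : ∀ b b' : List (Fin 4), b.Nodup ∧ b.length = 4 → b'.Nodup ∧ b'.length = 4 →
      ∀ c ∈ ({b} + {b'} : Multiset (List (Fin 4))), IsBlock 4 c := by
    intro b b' h h' c hc
    simp only [Multiset.mem_add, Multiset.mem_singleton] at hc
    rcases hc with rfl | rfl <;> assumption
  refine ⟨{[0, 1, 2, 3]} + {[3, 2, 1, 0]}, hblk _ _ (by decide) (by decide), ?_, ?_⟩
  · simp only [hcov]
    have h : ∀ x y : Fin 4, (x ≠ y →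
        ([x, y].Sublist [0, 1, 2, 3] ∧ ¬ [x, y].Sublist [3, 2, 1, 0]) ∨
        (¬ [x, y].Sublist [0, 1, 2, 3] ∧ [x, y].Sublist [3, 2, 1, 0])) ∧
        (x = y → ¬ [x, y].Sublist [0, 1, 2, 3] ∧ ¬ [x, y].Sublist [3, 2, 1, 0]) := by decide
    intro x y
    have := h x y
    grind
  · intro S hS hcard
    have hS : S = 0 := by
      simp only [Multiset.card_add, Multiset.card_singleton] at hcard
      have : Multiset.card S < 1 := by
        rify
        norm_num at hcard ⊢
        exact_mod_cast hcard
      simpa using this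
    subst hS
    refine ⟨{[1, 0, 2, 3]} + {[3, 2, 0, 1]}, hblk _ _ (by decide) (by decide), ?_,
      Multiset.zero_le _, ?_⟩
    · simp only [hcov]
      have h : ∀ x y : Fin 4, ([x, y].Sublist [1, 0, 2, 3] ∧ ¬ [x, y].Sublist [3, 2, 0, 1] ∨
        ¬ [x, y].Sublist [1, 0, 2, 3] ∧ [x, y].Sublist [3, 2, 0, 1]) ∧
        ([x, y].Sublist [0, 1, 2, 3] ∧ ¬ [x, y].Sublist [3, 2, 1, 0] ∨
        ¬ [x, y].Sublist [0, 1, 2, 3] ∧ [x, y].Sublist [3, 2, 1, 0]) ∨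
        (¬ [x, y].Sublist [1, 0, 2, 3] ∧ ¬ [x, y].Sublist [3, 2, 0, 1] ∧
        ¬ [x, y].Sublist [0, 1, 2, 3] ∧ ¬ [x, y].Sublist [3, 2, 1, 0]) := by decide
      intro x y
      have := h x y
      grind
    · intro e
      have : [1, 0, 2, 3] ∈ ({[0, 1, 2, 3]} + {[3, 2, 1, 0]} : Multiset (List (Fin 4))) := by
        rw [← e]; simp
      simp at this

/-- Double counting of the ordered pairs covered by blocks of size four. -/
lemma six_mul_card {α : Type} [Fintype α] {B : Multiset (List α)} (hB : ∀ b ∈ B, IsBlock 4 b) :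
    6 * Multiset.card B = ∑ x, ∑ y, cov B x y := by
  induction B using Multiset.induction_on with
  | empty => simp
  | cons b B ih =>
    have hone : ∑ x, ∑ y, cov {b} x y = 6 := by
      obtain ⟨p, q, r, s, rfl⟩ := List.length_eq_four.1 (hB b (by simp)).2
      have hn := (hB _ (Multiset.mem_cons_self _ _)).1
      have hsub : ∀ x y, [x, y].Sublist [p, q, r, s] ↔ (x, y) ∈
          ({(p, q), (p, r), (p, s), (q, r), (q, s), (r, s)} : Finset (α × α)) := by
        intro x y
        simp only [List.sublist_cons_iff]
        simp
        grind
      simp only [cov_singleton, hsub]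
      rw [← Fintype.sum_prod_type' (f := fun x y => if (x, y) ∈
        ({(p, q), (p, r), (p, s), (q, r), (q, s), (r, s)} : Finset (α × α)) then 1 else 0)]
      rw [Finset.sum_boole, Finset.filter_mem_eq_inter, Finset.univ_inter]
      simp at hn
      rw [Finset.card_insert_of_notMem, Finset.card_insert_of_notMem,
        Finset.card_insert_of_notMem, Finset.card_insert_of_notMem, Finset.card_insert_of_notMem,
        Finset.card_singleton]
      · rfl
      all_goals
        simp only [Finset.mem_insert, Finset.mem_singleton, Prod.mk.injEq]
        tauto
    rw [← Multiset.singleton_add]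
    simp only [cov_add, Finset.sum_add_distrib, hone, Multiset.card_add, Multiset.card_singleton]
    rw [← ih fun c hc => hB c (Multiset.mem_cons_of_mem hc)]
    ring

lemma sum_ne_add_card (X : Type) [Fintype X] :
    (∑ x : X, ∑ y : X, if x ≠ y then 1 else 0) + Fintype.card X =
      Fintype.card X * Fintype.card X := by
  have h : ∀ x : X, (∑ y : X, if x ≠ y then 1 else 0) + 1 = Fintype.card X := by
    intro x
    have : (∑ y : X, if x ≠ y then 1 else 0) + (∑ y : X, if x = y then 1 else 0) =
        Fintype.card X := by
      rw [← Finset.sum_add_distrib, Fintype.card_eq_sum_ones]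
      refine Finset.sum_congr rfl fun y _ => ?_
      by_cases h : x = y <;> simp [h]
    simpa using this
  calc _ = ∑ x : X, ((∑ y : X, if x ≠ y then 1 else 0) + 1) := by
        rw [Finset.sum_add_distrib]; simp
    _ = _ := by simp only [h]; simp

/-- Adjoining a point to a decomposition of the pairs in different groups of size three. -/
lemma Fillable.exists_design {X : Type} [Fintype X] (h : Fillable X) :
    ∃ (B : Multiset (List (Option (X × Fin 3)))) (h : ℚ), (∀ b ∈ B, IsBlock 4 b) ∧
      (∀ x y, cov B x y = if x ≠ y then 1 else 0) ∧ HitBound B h ∧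
      h = 5 / 8 * Multiset.card B - Fintype.card X / 4 := by
  obtain ⟨B₁, hB₁, hcov₁, hhit₁⟩ := h
  let f : X → Fin 4 → Option (X × Fin 3) := fun x =>
    ![some (x, 0), some (x, 1), some (x, 2), none]
  have hf : ∀ x, (f x).Injective := by
    intro x i j
    fin_cases i <;> fin_cases j <;> simp [f]
  have hD : Decomposable (1 / 2) fun p q : Option (X × Fin 3) =>
      p ≠ q ∧ ∀ a b, p = some a → q = some b → a.1 = b.1 := by
    refine Decomposable.glue f hf (fun _ => decomposable_ne_fin_four) ?_ ?_
    · intro x p q hpq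
      refine ⟨(hf x).ne hpq, ?_⟩
      intro a b
      fin_cases p <;> fin_cases q <;> simp [f] <;> rintro rfl rfl <;> rfl
    · have hsome : ∀ (x : X) (i : Fin 3), f x i.castSucc = some (x, i) := by
        intro x i
        fin_cases i <;> rfl
      have hnone : ∀ x, f x 3 = none := fun x => rfl
      have hinv : ∀ (x : X) (i : Fin 4) a, f x i = some a → a.1 = x := by
        intro x i a
        fin_cases i <;> simp [f] <;> rintro rfl <;> rfl
      rintro (_ | ⟨x, i⟩) (_ | ⟨y, j⟩) ⟨hne, hg⟩
      · exact absurd rfl hne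
      · refine ⟨y, ⟨3, j.castSucc, hnone y, hsome y j, ?_⟩, ?_⟩
        · exact fun e => by simpa [hnone, hsome] using congrArg (f y) e
        · rintro z ⟨p, q, -, hq, -⟩
          exact (hinv _ _ _ hq).symm
      · refine ⟨x, ⟨i.castSucc, 3, hsome x i, hnone x, ?_⟩, ?_⟩
        · exact fun e => by simpa [hnone, hsome] using congrArg (f x) e
        · rintro z ⟨p, q, hp, -, -⟩
          exact (hinv _ _ _ hp).symm
      · obtain rfl : x = y := hg _ _ rfl rfl
        refine ⟨x, ⟨i.castSucc, j.castSucc, hsome x i, hsome x j, ?_⟩, ?_⟩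
        · intro e
          exact hne (by rw [Fin.castSucc_injective _ e])
        · rintro z ⟨p, q, hp, -, -⟩
          exact (hinv _ _ _ hp).symm
  obtain ⟨B₂, hB₂, hcov₂, hhit₂⟩ := hD
  have hsome : (some : X × Fin 3 → Option (X × Fin 3)).Injective := Option.some_injective _
  have hB₁' : ∀ b ∈ B₁.map (List.map some), IsBlock 4 b := by
    intro b hb
    obtain ⟨b, h', rfl⟩ := Multiset.mem_map.1 hb
    exact (hB₁ b h').map hsome
  have hblk : ∀ b ∈ B₁.map (List.map some) + B₂, IsBlock 4 b := by
    intro b hb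
    rcases Multiset.mem_add.1 hb with hb | hb
    exacts [hB₁' b hb, hB₂ b hb]
  have hcov : ∀ x y, cov (B₁.map (List.map some) + B₂) x y = if x ≠ y then 1 else 0 := by
    intro x y
    rw [cov_add, hcov₂]
    rcases x with _ | x <;> rcases y with _ | y
    · rw [cov_map_eq_zero _ _ _ (by simp)]; simp
    · rw [cov_map_eq_zero _ _ _ (by simp)]; simp
    · rw [cov_map_eq_zero _ _ _ (by simp)]; simp
    · rw [cov_map_apply hsome, hcov₁]
      by_cases hxy : x.1 = y.1
      · simp [hxy]
      · have : x ≠ y := fun e => hxy (by rw [e])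
        simp [hxy, this]
  have hcard : 6 * Multiset.card (B₁.map (List.map some) + B₂) + (3 * Fintype.card X + 1) =
      (3 * Fintype.card X + 1) * (3 * Fintype.card X + 1) := by
    have := sum_ne_add_card (Option (X × Fin 3))
    rw [six_mul_card hblk]
    simp only [hcov]
    simpa [mul_comm] using this
  have hcard₁ : 6 * Multiset.card B₁ + 9 * Fintype.card X =
      9 * (Fintype.card X * Fintype.card X) := by
    rw [six_mul_card hB₁, ← sum_ne_add_card X]
    obtain ⟨g, hg⟩ : ∃ g : X → X → ℕ, ∀ x y, g x y = if x ≠ y then 1 else 0 :=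
      ⟨_, fun _ _ => rfl⟩
    have hpair : ∀ (x y : X) (i j : Fin 3), cov B₁ (x, i) (y, j) = g x y := by
      intro x y i j
      rw [hcov₁, hg]
      congr
    simp only [← hg, hpair, Fintype.sum_prod_type, Finset.sum_const, Finset.card_univ,
      Fintype.card_fin, smul_eq_mul, ← Finset.mul_sum]
    ring
  have hcard₂ : (Multiset.card B₂ : ℚ) = 2 * Fintype.card X := by
    rw [Multiset.card_add, Multiset.card_map] at hcard
    have : Multiset.card B₂ = 2 * Fintype.card X := by linarith
    exact_mod_cast this
  refine ⟨_, _, hblk, hcov, (hhit₁.map hsome).add hB₁' hB₂ hhit₂, ?_⟩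
  rw [Multiset.card_add, Multiset.card_map]
  push_cast
  rw [hcard₂]
  ring

end Fill

/-- A directed design covers every ordered pair of distinct points exactly once. -/
lemma isDD_iff_cov {α : Type*} {B : Multiset (List α)} :
    IsDD 2 4 1 B ↔ (∀ b ∈ B, IsBlock 4 b) ∧ ∀ x y, cov B x y = if x ≠ y then 1 else 0 := by
  refine and_congr_right fun hB => ⟨fun h x y => ?_, fun h s hs hl => ?_⟩
  · split_ifs with hxy
    · rw [cov, ← h [x, y] (by simpa using hxy) rfl]
    · obtain rfl : x = y := not_not.1 hxy
      rw [cov, Multiset.countP_eq_zero]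
      intro b hb hsub
      simpa using (hB b hb).1.sublist hsub
  · obtain ⟨x, y, rfl⟩ := List.length_eq_two.1 hl
    have hxy : x ≠ y := by simpa using hs
    have := h x y
    rw [if_pos hxy] at this
    rw [← this, cov]

/-- For every `v ≥ 64` with `v ≡ 4 (mod 12)` there is a
`2-(v,4,1)DD` (with `v(v-1)/6` blocks) whose every defining set contains at
least `(5/8 - 1/(2v))·(v(v-1)/6)` blocks. -/
theorem stmt8 (v : ℕ) (hv : 64 ≤ v) (hmod : v % 12 = 4) :
    ∃ B : Multiset (List (Fin v)),
      IsDD 2 4 1 B ∧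
      (Multiset.card B : ℝ) = (v : ℝ) * ((v : ℝ) - 1) / 6 ∧
      ∀ S : Multiset (List (Fin v)), IsDefiningSet 2 4 1 B S →
        (5 / 8 - 1 / (2 * (v : ℝ))) * ((v : ℝ) * ((v : ℝ) - 1) / 6)
          ≤ (Multiset.card S : ℝ) := by
  obtain ⟨u, rfl⟩ : ∃ u, v = 3 * u + 1 := ⟨v / 3, by omega⟩
  obtain ⟨B₀, h, hB₀, hcov₀, hhit₀, hh⟩ :=
    (fillable_of_mod_four u (by omega) (by omega)).exists_design
  let e : Option (Fin u × Fin 3) ≃ Fin (3 * u + 1) :=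
    Fintype.equivFinOfCardEq (by simp [mul_comm])
  have hB : IsDD 2 4 1 (B₀.map (List.map e)) := by
    refine isDD_iff_cov.2 ⟨?_, ?_⟩
    · intro b hb
      obtain ⟨b, h', rfl⟩ := Multiset.mem_map.1 hb
      exact (hB₀ b h').map e.injective
    · intro x y
      obtain ⟨p, rfl⟩ := e.surjective x
      obtain ⟨q, rfl⟩ := e.surjective y
      rw [cov_map_apply e.injective, hcov₀]
      simp
  have hcard : 6 * Multiset.card B₀ + (3 * u + 1) = (3 * u + 1) * (3 * u + 1) := by
    have := sum_ne_add_card (Option (Fin u × Fin 3))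
    rw [six_mul_card hB₀]
    simp only [hcov₀]
    simpa [mul_comm] using this
  have hcard : (Multiset.card B₀ : ℝ) =
      ((3 * u + 1 : ℕ) : ℝ) * (((3 * u + 1 : ℕ) : ℝ) - 1) / 6 := by
    have : (6 * Multiset.card B₀ + (3 * u + 1) : ℝ) = (3 * u + 1) * (3 * u + 1) := by
      exact_mod_cast hcard
    push_cast
    linarith
  refine ⟨_, hB, by rw [Multiset.card_map, hcard], ?_⟩
  rintro S ⟨hS, hdef⟩
  by_contra! hlt
  have hbound : (5 / 8 - 1 / (2 * ((3 * u + 1 : ℕ) : ℝ))) *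
      (((3 * u + 1 : ℕ) : ℝ) * (((3 * u + 1 : ℕ) : ℝ) - 1) / 6) = (h : ℝ) := by
    rw [hh]
    push_cast [Fintype.card_fin]
    rw [hcard]
    push_cast
    field_simp
    ring
  rw [hbound] at hlt
  obtain ⟨B', hB', hcov', hle, hne⟩ := (hhit₀.map e.injective) S hS (by exact_mod_cast hlt)
  refine hne (hdef B' (isDD_iff_cov.2 ⟨hB', fun x y => ?_⟩) hle)
  rw [hcov', (isDD_iff_cov.1 hB).2]
end

section
/- For every integer v ≥ 70 with v ≡ 10 (mod 12), there exists a 2-(v,4,1) directed design (which has v(v−1)/6 blocks) whose smallest defining sets contain at least (5/8 − 1/(4v) − 1/(2v))·(v(v−1)/6) blocks. -/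
open scoped Classical

namespace DirectedDesign

variable {P Q : Type*}

/-- Two blocks are tradable if some pair is adjacent in both of them, in opposite orders. -/
def Tradable (b c : List P) : Prop :=
  ∃ x ∈ b, ∃ y ∈ b, [x, y] <:+: b ∧ [y, x] <:+: c

/-- Some set of blocks of size 4 contains every pair of the relation `A` exactly once and no
other pair, and every subset of it that meets each pair of tradable blocks has at least `h`
blocks. -/
def Good (A : P → P → Prop) (h : ℕ) : Prop :=
  ∃ B : Finset (List P), (∀ b ∈ B, b.Nodup ∧ b.length = 4) ∧
    (∀ x y, A x y → ∃! b, b ∈ B ∧ [x, y].Sublist b) ∧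
    (∀ b ∈ B, ∀ x y, [x, y].Sublist b → A x y) ∧
    ∀ S ⊆ B, (∀ b ∈ B, ∀ c ∈ B, Tradable b c → b ∈ S ∨ c ∈ S) → h ≤ S.card

theorem exists_arc {b : List P} (hb : b.length = 4) : ∃ x y, [x, y].Sublist b := by
  match b, hb with
  | [x, y, z, w], _ => exact ⟨x, y, by simp⟩

theorem Tradable.map {b c : List P} (f : P → Q) : Tradable b c → Tradable (b.map f) (c.map f) := by
  rintro ⟨x, hx, y, hy, h, h'⟩
  exact ⟨f x, List.mem_map_of_mem hx, f y, List.mem_map_of_mem hy,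
    by simpa using h.map f, by simpa using h'.map f⟩

theorem Good.of_blocks {A : P → P → Prop} {J I : Type*} [Fintype J] [Fintype I]
    (blk : J → List P) (key : J → I) (hb : ∀ j, (blk j).Nodup ∧ (blk j).length = 4)
    (hA : ∀ x y, A x y → ∃! j, [x, y].Sublist (blk j))
    (hA' : ∀ j x y, [x, y].Sublist (blk j) → A x y)
    (ht : ∀ j k, j ≠ k → key j = key k → Tradable (blk j) (blk k)) :
    Good A (Fintype.card J - Fintype.card I) := by
  have hinj : Function.Injective blk := fun j k hjk => by
    obtain ⟨x, y, h⟩ := exists_arc (hb j).2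
    exact (hA x y (hA' _ _ _ h)).unique h (hjk ▸ h)
  refine ⟨Finset.univ.image blk, by simpa using hb, fun x y hxy => ?_, by simpa using hA', ?_⟩
  · obtain ⟨j, hj, hu⟩ := hA x y hxy
    refine ⟨blk j, ⟨by simp, hj⟩, ?_⟩
    rintro _ ⟨hk, hs⟩
    obtain ⟨k, -, rfl⟩ := Finset.mem_image.1 hk
    rw [hu k hs]
  · intro S hS hmeet
    have h1 : (Finset.univ.filter fun j => blk j ∉ S).card ≤ Fintype.card I := by
      rw [← Finset.card_univ]
      refine Finset.card_le_card_of_injOn key (by simp) fun j hj k hk hjk => ?_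
      by_contra hne
      rcases hmeet (blk j) (by simp) (blk k) (by simp) (ht j k hne hjk) with h | h
      · exact (Finset.mem_filter.1 hj).2 h
      · exact (Finset.mem_filter.1 hk).2 h
    have h2 : (Finset.univ.filter fun j => blk j ∈ S).card ≤ S.card :=
      Finset.card_le_card_of_injOn blk (fun j hj => (Finset.mem_filter.1 hj).2) hinj.injOn
    have h3 := Finset.card_filter_add_card_filter_not (s := (Finset.univ : Finset J))
      fun j => blk j ∈ S
    rw [Finset.card_univ] at h3
    omega

theorem Good.iUnion {ι : Type*} [Fintype ι] {A : P → P → Prop} {R : ι → P → P → Prop} {h : ι → ℕ}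
    (hR : ∀ i, Good (R i) (h i)) (hA : ∀ x y, A x y → ∃! i, R i x y)
    (hA' : ∀ i x y, R i x y → A x y) : Good A (∑ i, h i) := by
  choose B hb hu hr hS using hR
  have hdisj : ∀ i j b, b ∈ B i → b ∈ B j → i = j := fun i j b hi hj => by
    obtain ⟨x, y, hxy⟩ := exists_arc (hb i b hi).2
    have h1 := hr i b hi x y hxy
    exact (hA x y (hA' i x y h1)).unique h1 (hr j b hj x y hxy)
  refine ⟨Finset.univ.biUnion B, fun b hbB => ?_, fun x y hxy => ?_, fun b hbB x y hxy => ?_,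
    fun S hSB hmeet => ?_⟩
  · obtain ⟨i, -, hi⟩ := Finset.mem_biUnion.1 hbB
    exact hb i b hi
  · obtain ⟨i, hi, hiu⟩ := hA x y hxy
    obtain ⟨b, ⟨hbi, hbs⟩, hbu⟩ := hu i x y hi
    refine ⟨b, ⟨Finset.mem_biUnion.2 ⟨i, Finset.mem_univ i, hbi⟩, hbs⟩, ?_⟩
    rintro c ⟨hc, hcs⟩
    obtain ⟨j, -, hj⟩ := Finset.mem_biUnion.1 hc
    obtain rfl := hiu j (hr j c hj x y hcs)
    exact hbu c ⟨hj, hcs⟩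
  · obtain ⟨i, -, hi⟩ := Finset.mem_biUnion.1 hbB
    exact hA' i x y (hr i b hi x y hxy)
  · have h1 : ∀ i, h i ≤ (S ∩ B i).card := fun i =>
      hS i _ Finset.inter_subset_right fun b hbi c hci ht => by
        have := hmeet b (Finset.mem_biUnion.2 ⟨i, Finset.mem_univ i, hbi⟩) c
          (Finset.mem_biUnion.2 ⟨i, Finset.mem_univ i, hci⟩) ht
        simpa [hbi, hci] using this
    calc ∑ i, h i ≤ ∑ i, (S ∩ B i).card := Finset.sum_le_sum fun i _ => h1 i
      _ = (Finset.univ.biUnion fun i => S ∩ B i).card := by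
        rw [Finset.card_biUnion]
        intro i _ j _ hij
        rw [Function.onFun, Finset.disjoint_left]
        intro b hbi hbj
        exact hij (hdisj i j b (Finset.mem_inter.1 hbi).2 (Finset.mem_inter.1 hbj).2)
      _ ≤ S.card := Finset.card_le_card (Finset.biUnion_subset.2 fun i _ =>
        Finset.inter_subset_left)

theorem Good.empty {A : P → P → Prop} (hA : ∀ x y, ¬ A x y) : Good A 0 :=
  ⟨∅, by simp, fun x y h => (hA x y h).elim, by simp, by simp⟩

theorem pair_sublist_map {f : P → Q} {b : List P} {x y : Q} :
    [x, y].Sublist (b.map f) ↔ ∃ u v, [u, v].Sublist b ∧ f u = x ∧ f v = y := by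
  rw [List.sublist_map_iff]
  constructor
  · rintro ⟨l, hl, h⟩
    match l, h with
    | [u, v], h =>
      simp only [List.map_cons, List.map_nil, List.cons.injEq] at h
      exact ⟨u, v, hl, h.1.symm, h.2.1.symm⟩
  · rintro ⟨u, v, h, rfl, rfl⟩
    exact ⟨[u, v], h, rfl⟩

theorem Good.map {A : P → P → Prop} {h : ℕ} (hA : Good A h) {f : P → Q} (hf : f.Injective) :
    Good (Relation.Map A f f) h := by
  obtain ⟨B, hb, hu, hr, hS⟩ := hA
  have hf' : Function.Injective (List.map f) := List.map_injective_iff.2 hf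
  refine ⟨B.image (List.map f), ?_, ?_, ?_, fun S hSB hmeet => ?_⟩
  · simpa [List.nodup_map_iff hf] using hb
  · rintro _ _ ⟨x, y, hxy, rfl, rfl⟩
    obtain ⟨b, ⟨hbB, hbs⟩, hbu⟩ := hu x y hxy
    refine ⟨b.map f, ⟨Finset.mem_image_of_mem _ hbB, pair_sublist_map.2 ⟨x, y, hbs, rfl, rfl⟩⟩, ?_⟩
    rintro _ ⟨hc, hcs⟩
    obtain ⟨c, hcB, rfl⟩ := Finset.mem_image.1 hc
    obtain ⟨u, v, huv, hu', hv'⟩ := pair_sublist_map.1 hcs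
    rw [hf hu', hf hv'] at huv
    rw [hbu c ⟨hcB, huv⟩]
  · intro c hc x y hxy
    obtain ⟨b, hbB, rfl⟩ := Finset.mem_image.1 hc
    obtain ⟨u, v, huv, rfl, rfl⟩ := pair_sublist_map.1 hxy
    exact ⟨u, v, hr b hbB u v huv, rfl, rfl⟩
  · have h1 := hS (B.filter fun b => b.map f ∈ S) (Finset.filter_subset _ _)
      fun b hbB c hcB ht => by
        simpa [hbB, hcB] using hmeet _ (Finset.mem_image_of_mem _ hbB) _
          (Finset.mem_image_of_mem _ hcB) (ht.map f)
    exact h1.trans (Finset.card_le_card_of_injOn (List.map f)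
      (fun b hb => (Finset.mem_filter.1 hb).2) hf'.injOn)

theorem pair_sublist_cons {l : List P} {x u w : P} :
    [u, w].Sublist (x :: l) ↔ [u, w].Sublist l ∨ u = x ∧ w ∈ l := by
  simp [List.sublist_cons_iff]

theorem pair_sublist_swap {x y u w : P} {l₁ l₂ : List P} (h₁ : ¬ (u = x ∧ w = y))
    (h₂ : ¬ (u = y ∧ w = x)) :
    [u, w].Sublist (l₁ ++ x :: y :: l₂) ↔ [u, w].Sublist (l₁ ++ y :: x :: l₂) := by
  induction l₁ with
  | nil => simp only [List.nil_append, pair_sublist_cons, List.mem_cons]; tauto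
  | cons a l ih =>
    simp only [List.cons_append, pair_sublist_cons, ih, List.mem_append, List.mem_cons]; tauto

theorem not_pair_sublist_of_nodup {x y : P} {l : List P} (hl : l.Nodup) (h : [x, y].Sublist l) :
    ¬ [y, x].Sublist l := by
  induction l with
  | nil => simp at h
  | cons a l ih =>
    rw [List.nodup_cons] at hl
    rw [pair_sublist_cons] at h ⊢
    rcases h with h | ⟨rfl, h⟩
    · rintro (h' | ⟨rfl, h'⟩)
      · exact ih hl.2 h h'
      · exact hl.1 (h.subset (by simp))
    · rintro (h' | ⟨rfl, h'⟩)
      · exact hl.1 (h'.subset (by simp))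
      · exact hl.1 h'

theorem eq_of_countP_eq_one {B : Multiset P} {p : P → Prop} [DecidablePred p]
    (h : B.countP p = 1) {b c : P} (hb : b ∈ B) (hc : c ∈ B) (pb : p b) (pc : p c) : b = c := by
  rw [Multiset.countP_eq_card_filter, Multiset.card_eq_one] at h
  obtain ⟨a, ha⟩ := h
  have h1 : b ∈ B.filter p := Multiset.mem_filter.2 ⟨hb, pb⟩
  have h2 : c ∈ B.filter p := Multiset.mem_filter.2 ⟨hc, pc⟩
  rw [ha, Multiset.mem_singleton] at h1 h2
  rw [h1, h2]

theorem _root_.IsDD.exchange {x y : P} {l₁ l₂ l₃ l₄ : List P} {R : Multiset (List P)}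
    (h : IsDD 2 4 1 ((l₁ ++ x :: y :: l₂) ::ₘ (l₃ ++ y :: x :: l₄) ::ₘ R)) :
    IsDD 2 4 1 ((l₁ ++ y :: x :: l₂) ::ₘ (l₃ ++ x :: y :: l₄) ::ₘ R) := by
  have hb := h.1 (l₁ ++ x :: y :: l₂) (by simp)
  have hc := h.1 (l₃ ++ y :: x :: l₄) (by simp)
  have perm (l l' : List P) (x y : P) : (l ++ x :: y :: l').Perm (l ++ y :: x :: l') :=
    (List.Perm.swap y x l').append_left l
  have block (l l' : List P) (x y : P) (h : IsBlock 4 (l ++ x :: y :: l')) :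
      IsBlock 4 (l ++ y :: x :: l') :=
    ⟨(perm l l' x y).nodup_iff.1 h.1, (perm l l' x y).length_eq ▸ h.2⟩
  have arc (l l' : List P) (x y : P) : [x, y].Sublist (l ++ x :: y :: l') :=
    .trans (by simp) (List.sublist_append_right l _)
  have hb' := block _ _ _ _ hb
  have hc' := block _ _ _ _ hc
  refine ⟨fun d hd => ?_, fun s hs hs2 => ?_⟩
  · simp only [Multiset.mem_cons] at hd
    rcases hd with rfl | rfl | hd
    · exact hb'
    · exact hc'
    · exact h.1 d (by simp [hd])
  · rw [← h.2 s hs hs2]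
    obtain ⟨u, w, rfl⟩ := List.length_eq_two.1 hs2
    simp only [Multiset.countP_cons]
    by_cases h₁ : u = x ∧ w = y
    · obtain ⟨rfl, rfl⟩ := h₁
      rw [if_pos (arc l₁ l₂ u w), if_pos (arc l₃ l₄ u w),
        if_neg (not_pair_sublist_of_nodup hb'.1 (arc l₁ l₂ w u)),
        if_neg (not_pair_sublist_of_nodup hc.1 (arc l₃ l₄ w u))]
    by_cases h₂ : u = y ∧ w = x
    · obtain ⟨rfl, rfl⟩ := h₂
      rw [if_pos (arc l₁ l₂ u w), if_pos (arc l₃ l₄ u w),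
        if_neg (not_pair_sublist_of_nodup hb.1 (arc l₁ l₂ w u)),
        if_neg (not_pair_sublist_of_nodup hc'.1 (arc l₃ l₄ w u))]
    rw [if_congr (pair_sublist_swap (l₁ := l₁) (l₂ := l₂) h₁ h₂) rfl rfl,
      if_congr (pair_sublist_swap (l₁ := l₃) (l₂ := l₄) h₁ h₂) rfl rfl]

theorem _root_.IsDD.exchange_notMem {x y : P} {l₁ l₂ : List P} {B : Multiset (List P)}
    (h : IsDD 2 4 1 B) (hb : l₁ ++ x :: y :: l₂ ∈ B) : l₁ ++ y :: x :: l₂ ∉ B := by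
  intro hb'
  have hB := h.1 _ hb
  have hxy : x ≠ y := by
    rintro rfl
    simpa [List.nodup_append] using hB.1
  have key (u w : P) (h₁ : ¬ (u = x ∧ w = y)) (h₂ : ¬ (u = y ∧ w = x))
      (huw : [u, w].Sublist (l₁ ++ x :: y :: l₂)) : False := by
    have h3 := eq_of_countP_eq_one (h.2 [u, w] (hB.1.sublist huw) rfl) hb hb' huw
      ((pair_sublist_swap h₁ h₂).1 huw)
    simp [hxy] at h3
  have hlen := hB.2
  match l₁, l₂ with
  | z :: l₁, l₂ =>
    have hz : z ∉ l₁ ++ x :: y :: l₂ := (List.nodup_cons.1 hB.1).1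
    refine key z x (fun h => ?_) (fun h => ?_) ?_
    · exact hz (by simp [h.1])
    · exact hz (by simp [h.1])
    · rw [List.cons_append, pair_sublist_cons]
      simp
  | [], z :: l₂ =>
    have hz : z ≠ x ∧ z ≠ y := by
      have := hB.1
      simp only [List.nil_append, List.nodup_cons, List.mem_cons] at this
      grind
    refine key x z (by simp [hz.2]) (by simp [hxy]) ?_
    rw [List.nil_append, pair_sublist_cons]
    simp
  | [], [] => simp at hlen

theorem _root_.IsDefiningSet.mem_or_mem {B S : Multiset (List P)} (hB : IsDD 2 4 1 B) (hn : B.Nodup)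
    (hS : IsDefiningSet 2 4 1 B S) {b c : List P} (hb : b ∈ B) (hc : c ∈ B) (ht : Tradable b c) :
    b ∈ S ∨ c ∈ S := by
  by_contra! hmem
  obtain ⟨x, -, y, -, ⟨l₁, l₂, rfl⟩, l₃, l₄, rfl⟩ := ht
  simp only [List.append_assoc, List.cons_append, List.nil_append] at *
  have hne : l₁ ++ x :: y :: l₂ ≠ l₃ ++ y :: x :: l₄ := by
    intro h
    refine not_pair_sublist_of_nodup (hB.1 _ hb).1 (x := x) (y := y)
      (.trans (by simp) (List.sublist_append_right l₁ _)) ?_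
    rw [h]
    exact .trans (by simp) (List.sublist_append_right l₃ _)
  obtain ⟨R, hR⟩ := Multiset.exists_cons_of_mem hb
  have hcR : l₃ ++ y :: x :: l₄ ∈ R := by
    rw [hR, Multiset.mem_cons] at hc
    exact hc.resolve_left hne.symm
  obtain ⟨R, rfl⟩ := Multiset.exists_cons_of_mem hcR
  have hSn := Multiset.nodup_of_le hS.1 hn
  have hSR : S ≤ R := by
    rw [Multiset.le_iff_subset hSn]
    intro d hd
    have hdB := Multiset.mem_of_le hS.1 hd
    rw [hR, Multiset.mem_cons, Multiset.mem_cons] at hdB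
    rcases hdB with rfl | rfl | h
    · exact (hmem.1 hd).elim
    · exact (hmem.2 hd).elim
    · exact h
  have h1 := hS.2 _ (IsDD.exchange (hR ▸ hB))
    (hSR.trans ((Multiset.le_cons_self _ _).trans (Multiset.le_cons_self _ _)))
  exact hB.exchange_notMem hb (h1 ▸ by simp)

theorem card_pairs_sublist [Fintype P] {b : List P}
    [DecidablePred fun p : P × P => [p.1, p.2].Sublist b] (hn : b.Nodup) (hb : b.length = 4) :
    (Finset.univ.filter fun p : P × P => [p.1, p.2].Sublist b).card = 6 := by
  obtain ⟨x, y, z, w, rfl⟩ : ∃ x y z w, b = [x, y, z, w] := by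
    match b, hb with
    | [x, y, z, w], _ => exact ⟨x, y, z, w, rfl⟩
  have h : (Finset.univ.filter fun p : P × P => [p.1, p.2].Sublist [x, y, z, w]) =
      {(x, y), (x, z), (x, w), (y, z), (y, w), (z, w)} := by
    ext ⟨u, v⟩
    simp [pair_sublist_cons]
    tauto
  rw [h]
  simp only [List.nodup_cons, List.mem_cons, List.not_mem_nil] at hn
  repeat rw [Finset.card_insert_of_notMem (by simp; grind)]
  simp

theorem Good.exists_isDD {v h : ℕ} (hG : Good (fun x y : Fin v => x ≠ y) h) :
    ∃ B : Multiset (List (Fin v)), IsDD 2 4 1 B ∧ 6 * Multiset.card B = v * (v - 1) ∧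
      ∀ S : Multiset (List (Fin v)), IsDefiningSet 2 4 1 B S → h ≤ Multiset.card S := by
  obtain ⟨B, hb, hu, hr, hS⟩ := hG
  have hDD : IsDD 2 4 1 B.val := by
    refine ⟨hb, fun s hs hs2 => ?_⟩
    obtain ⟨x, y, rfl⟩ := List.length_eq_two.1 hs2
    obtain ⟨b, ⟨hbB, hbs⟩, hbu⟩ := hu x y (by simpa using hs)
    rw [Multiset.countP_eq_card_filter, ← Finset.filter_val, Finset.card_val, Finset.card_eq_one]
    refine ⟨b, ?_⟩
    ext c
    simp only [Finset.mem_filter, Finset.mem_singleton]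
    exact ⟨hbu c, fun h => h ▸ ⟨hbB, hbs⟩⟩
  refine ⟨B.val, hDD, ?_, fun S hSd => ?_⟩
  · have h1 : (B.biUnion fun b =>
        Finset.univ.filter fun p : Fin v × Fin v => [p.1, p.2].Sublist b) =
        Finset.univ.offDiag := by
      ext ⟨x, y⟩
      simp only [Finset.mem_biUnion, Finset.mem_filter, Finset.mem_univ, true_and,
        Finset.mem_offDiag]
      exact ⟨fun ⟨b, hbB, h⟩ => hr b hbB x y h, fun h => (hu x y h).exists⟩
    have h2 := congrArg Finset.card h1
    rw [Finset.card_biUnion, Finset.sum_congr rfl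
      fun b hbB => card_pairs_sublist (hb b hbB).1 (hb b hbB).2, Finset.sum_const,
      Finset.offDiag_card, Finset.card_univ, Fintype.card_fin, smul_eq_mul] at h2
    · rw [Finset.card_val, mul_comm, h2, Nat.mul_sub_one]
    · intro b hbB c hcB hne
      rw [Function.onFun, Finset.disjoint_left]
      rintro ⟨x, y⟩ h3 h4
      simp only [Finset.mem_filter, Finset.mem_univ, true_and] at h3 h4
      exact hne ((hu x y (hr b hbB x y h3)).unique ⟨hbB, h3⟩ ⟨hcB, h4⟩)
  · have h1 := hS S.toFinset (fun b hbS => Multiset.mem_of_le hSd.1 (Multiset.mem_toFinset.1 hbS))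
      fun b hbB c hcB ht => by
        simpa using hSd.mem_or_mem hDD B.nodup hbB hcB ht
    exact h1.trans (Multiset.toFinset_card_le S)

theorem Good.congr {A A' : P → P → Prop} {h : ℕ} (hA : Good A h) (hAA' : ∀ x y, A x y ↔ A' x y) :
    Good A' h := by
  obtain rfl : A = A' := by
    ext x y
    exact hAA' x y
  exact hA

theorem Good.of_equiv {A : P → P → Prop} {A' : Q → Q → Prop} {h : ℕ} (hA : Good A h) (e : P ≃ Q)
    (he : ∀ x y, A x y ↔ A' (e x) (e y)) : Good A' h := by
  refine (hA.map e.injective).congr fun x y => ⟨?_, fun hxy => ?_⟩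
  · rintro ⟨u, v, huv, rfl, rfl⟩
    exact (he u v).1 huv
  · exact ⟨e.symm x, e.symm y, (he _ _).2 (by simpa using hxy), by simp, by simp⟩

/-- There is a good set of blocks for the complete relation on `3 * m + 1` points. -/
def Full (m h : ℕ) : Prop :=
  Good (fun x y : Option (Fin m × Fin 3) => x ≠ y) h

/-- There is a good set of blocks for the pairs meeting two of `m` groups of size 3. -/
def Gdd (m h : ℕ) : Prop :=
  Good (fun x y : Fin m × Fin 3 => x.1 ≠ y.1) h

theorem Full.of_good {X : Type*} [Fintype X] {m h : ℕ} (hX : Fintype.card X = 3 * m + 1)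
    (hG : Good (fun x y : X => x ≠ y) h) : Full m h :=
  hG.of_equiv (Fintype.equivOfCardEq (by simp [hX, mul_comm])) (by simp)

theorem Full.good {X : Type*} [Fintype X] {m h : ℕ} (hG : Full m h)
    (hX : Fintype.card X = 3 * m + 1) : Good (fun x y : X => x ≠ y) h :=
  Good.of_equiv hG (Fintype.equivOfCardEq (by simp [hX, mul_comm])) (by simp)

theorem Gdd.of_good {X M : Type*} [Fintype X] [Fintype M] [DecidableEq M] {h : ℕ} (q : X → M)
    (hq : ∀ k, Fintype.card {x // q x = k} = 3) (hG : Good (fun x y : X => q x ≠ q y) h) :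
    Gdd (Fintype.card M) h := by
  let f (k : M) : {x // q x = k} ≃ Fin 3 := Fintype.equivFinOfCardEq (hq k)
  let e : X ≃ M × Fin 3 := (Equiv.sigmaFiberEquiv q).symm.trans
    ((Equiv.sigmaCongrRight f).trans (Equiv.sigmaEquivProd M (Fin 3)))
  refine hG.of_equiv (e.trans (Equiv.prodCongr (Fintype.equivFin M) (Equiv.refl _))) fun x y => ?_
  have he (x : X) : (e x).1 = q x := rfl
  simp [he]

/-- A pairwise balanced design with a partition of its points into groups: the blocks are filled
with group divisible designs, the groups with designs through a common point. -/
theorem Full.of_pbd {M κ ι : Type*} [Fintype M] [Fintype κ] [DecidableEq κ] [Fintype ι]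
    (q : M → κ) (T : ι → Finset M) {h : ι → ℕ} {g : κ → ℕ} (hq : ∀ i, Set.InjOn q (T i))
    (hT : ∀ x y, q x ≠ q y → ∃! i, x ∈ T i ∧ y ∈ T i) (hG : ∀ i, Gdd (T i).card (h i))
    (hF : ∀ k, Full (Fintype.card {x // q x = k}) (g k)) :
    Full (Fintype.card M) (∑ i, h i + ∑ k, g k) := by
  have hG' (i : ι) : Good (fun x y : Option (M × Fin 3) => ∃ a b s t, a ∈ T i ∧ b ∈ T i ∧ a ≠ b ∧
      x = some (a, s) ∧ y = some (b, t)) (h i) := by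
    let e := (T i).equivFin.symm
    let f (p : Fin (T i).card × Fin 3) : Option (M × Fin 3) := some ((e p.1 : M), p.2)
    have hf : f.Injective := by
      rintro ⟨a, s⟩ ⟨b, t⟩ h
      simpa [f] using h
    refine (Good.map (hG i) hf).congr fun x y => ⟨?_, ?_⟩
    · rintro ⟨⟨a, s⟩, ⟨b, t⟩, hab, rfl, rfl⟩
      exact ⟨e a, e b, s, t, (e a).2, (e b).2, by simpa [Subtype.ext_iff] using hab, rfl, rfl⟩
    · rintro ⟨a, b, s, t, ha, hb, hab, rfl, rfl⟩
      exact ⟨(e.symm ⟨a, ha⟩, s), (e.symm ⟨b, hb⟩, t), by simpa using hab, by simp [f], by simp [f]⟩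
  have hF' (k : κ) : Good (fun x y : Option (M × Fin 3) => x ≠ y ∧ (∀ p ∈ x, q p.1 = k) ∧
      ∀ p ∈ y, q p.1 = k) (g k) := by
    let f : Option ({x // q x = k} × Fin 3) → Option (M × Fin 3) :=
      Option.map (Prod.map Subtype.val id)
    have hf : f.Injective := Option.map_injective (Subtype.val_injective.prodMap fun _ _ h => h)
    have hr (x : Option (M × Fin 3)) (hx : ∀ p ∈ x, q p.1 = k) : ∃ u, f u = x := by
      match x, hx with
      | none, _ => exact ⟨none, rfl⟩
      | some p, hx => exact ⟨some (⟨p.1, hx p rfl⟩, p.2), rfl⟩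
    have hr' (u : Option ({x // q x = k} × Fin 3)) : ∀ p ∈ f u, q p.1 = k := by
      match u with
      | none => simp [f]
      | some p =>
        rintro _ ⟨⟩
        exact p.1.2
    refine (((hF k).good (X := Option ({x // q x = k} × Fin 3))
      (by simp [mul_comm])).map hf).congr fun x y => ⟨?_, ?_⟩
    · rintro ⟨u, v, huv, rfl, rfl⟩
      exact ⟨hf.ne huv, hr' u, hr' v⟩
    · rintro ⟨hxy, hx, hy⟩
      obtain ⟨u, rfl⟩ := hr x hx
      obtain ⟨v, rfl⟩ := hr y hy
      exact ⟨u, v, fun h => hxy (h ▸ rfl), rfl, rfl⟩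
  refine Full.of_good (X := Option (M × Fin 3)) (by simp [mul_comm]) ?_
  have hsum : ∑ i, h i + ∑ k, g k = ∑ j, Sum.elim h g j := by simp
  rw [hsum]
  refine Good.iUnion (R := Sum.elim (fun i x y => ∃ a b s t, a ∈ T i ∧ b ∈ T i ∧ a ≠ b ∧
      x = some (a, s) ∧ y = some (b, t)) fun k x y => x ≠ y ∧ (∀ p ∈ x, q p.1 = k) ∧
      ∀ p ∈ y, q p.1 = k) ?_ ?_ ?_
  · rintro (i | k)
    · exact hG' i
    · exact hF' k
  · intro x y hxy
    by_cases hk : ∃ k, (∀ p ∈ x, q p.1 = k) ∧ ∀ p ∈ y, q p.1 = k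
    · obtain ⟨k, hx, hy⟩ := hk
      refine ⟨.inr k, ⟨hxy, hx, hy⟩, ?_⟩
      rintro (i | k') h
      · obtain ⟨a, b, s, t, ha, hb, hab, rfl, rfl⟩ := h
        exact (hab (hq i ha hb ((hx _ rfl).trans (hy _ rfl).symm))).elim
      · obtain ⟨-, hx', hy'⟩ := h
        congr 1
        match x, y with
        | some p, _ => rw [← hx p rfl, hx' p rfl]
        | none, some p => rw [← hy p rfl, hy' p rfl]
        | none, none => exact (hxy rfl).elim
    · match x, y with
      | none, none => exact (hxy rfl).elim
      | some p, none => exact (hk ⟨q p.1, by rintro _ ⟨⟩; rfl, by simp⟩).elim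
      | none, some p => exact (hk ⟨q p.1, by simp, by rintro _ ⟨⟩; rfl⟩).elim
      | some (a, s), some (b, t) =>
        have hab : q a ≠ q b := fun h =>
          hk ⟨q a, by rintro _ ⟨⟩; rfl, by rintro _ ⟨⟩; exact h.symm⟩
        obtain ⟨i, hi, hu⟩ := hT a b hab
        refine ⟨.inl i, ⟨a, b, s, t, hi.1, hi.2, fun h => hab (h ▸ rfl), rfl, rfl⟩, ?_⟩
        rintro (j | k) h
        · obtain ⟨a', b', s', t', ha, hb, -, h1, h2⟩ := h
          cases h1
          cases h2
          rw [hu j ⟨ha, hb⟩]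
        · exact (hk ⟨k, h.2⟩).elim
  · rintro (i | k) x y h
    · obtain ⟨a, b, s, t, -, -, hab, rfl, rfl⟩ := h
      simpa using fun h => (hab h).elim
    · exact h.1

/-- Blocks developed by a family of injections `act`. -/
theorem Good.of_development {A : P → P → Prop} {G K I : Type*} [Fintype G] [Fintype K] [Fintype I]
    (act : G → P → P) (hact : ∀ g, (act g).Injective) (base : K → List P) (key : K → I)
    (hb : ∀ k, (base k).Nodup ∧ (base k).length = 4)
    (ht : ∀ k l, k ≠ l → key k = key l → Tradable (base k) (base l))
    (hA : ∀ x y, A x y → ∃! j : G × K, [x, y].Sublist ((base j.2).map (act j.1)))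
    (hA' : ∀ j : G × K, ∀ x y, [x, y].Sublist (base j.2) → A (act j.1 x) (act j.1 y)) :
    Good A (Fintype.card G * Fintype.card K - Fintype.card G * Fintype.card I) := by
  rw [← Fintype.card_prod, ← Fintype.card_prod]
  refine Good.of_blocks (fun j : G × K => (base j.2).map (act j.1))
    (fun j : G × K => (j.1, key j.2)) ?_ hA ?_ ?_
  · exact fun j => ⟨(hb j.2).1.map (hact j.1), by simp [(hb j.2).2]⟩
  · intro j x y h
    obtain ⟨u, v, huv, rfl, rfl⟩ := pair_sublist_map.1 h
    exact hA' j u v huv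
  · rintro ⟨g, k⟩ ⟨g', l⟩ hne h
    obtain ⟨rfl, h⟩ := Prod.mk.injEq .. ▸ h
    exact (ht k l (fun h' => hne (h' ▸ rfl)) h).map _

/-- Blocks developed by the translations of a group, relative to the kernel of `q`. -/
theorem Gdd.of_translation {G M K I : Type*} [AddCommGroup G] [AddCommGroup M] [Fintype G]
    [Fintype M] [DecidableEq G] [DecidableEq M] [Fintype K] [Fintype I] (q : G →+ M)
    (hq : ∀ k, Fintype.card {x // q x = k} = 3) (base : K → List G) (key : K → I)
    (hb : ∀ k, (base k).Nodup ∧ (base k).length = 4)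
    (ht : ∀ k l, k ≠ l → key k = key l → Tradable (base k) (base l))
    (hA : ∀ d, q d ≠ 0 → ∃! j : G × K, [j.1, j.1 + d].Sublist (base j.2))
    (hA' : ∀ k, (base k).Pairwise fun x y => q x ≠ q y) :
    Gdd (Fintype.card M) (Fintype.card G * Fintype.card K - Fintype.card G * Fintype.card I) := by
  refine Gdd.of_good q hq (Good.of_development (fun g x => g + x) (fun g => add_right_injective g)
    base key hb ht (fun x y hxy => ?_) fun j x y h => ?_)
  · obtain ⟨⟨z, k⟩, hzk, hu⟩ := hA (y - x) (by rwa [map_sub, sub_ne_zero, ne_comm])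
    refine ⟨(x - z, k), pair_sublist_map.2 ⟨_, _, hzk, by simp, by dsimp only; abel⟩, ?_⟩
    rintro ⟨g, l⟩ h
    obtain ⟨u, v, huv, rfl, rfl⟩ := pair_sublist_map.1 h
    have := hu (u, l) (by simpa using huv)
    simp only [Prod.mk.injEq] at this
    simp [← this.1, this.2]
  · simpa using (hA' j.2).sublist h

instance [DecidableEq P] (b c : List P) : Decidable (Tradable b c) :=
  inferInstanceAs (Decidable (∃ x ∈ b, ∃ y ∈ b, [x, y] <:+: b ∧ [y, x] <:+: c))

instance {α : Type*} [Fintype α] [DecidableEq α] (p : α → Prop) [DecidablePred p] :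
    Decidable (∃! x, p x) :=
  inferInstanceAs (Decidable (∃ x, p x ∧ ∀ y, p y → y = x))

theorem gdd_four : Gdd 4 12 :=
  Good.of_development (G := Fin 3)
    (fun g p => (p.1, if p.1 = 0 then p.2 else g + p.2)) (by decide +kernel)
    ![[(0, 0), (1, 0), (2, 0), (3, 0)], [(0, 2), (2, 0), (1, 0), (3, 2)],
      [(1, 2), (3, 0), (2, 0), (0, 2)], [(3, 0), (2, 2), (1, 0), (0, 0)],
      [(0, 1), (2, 2), (3, 0), (1, 1)], [(3, 1), (1, 0), (2, 2), (0, 1)]]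
    (I := Fin 2) ![0, 0, 0, 1, 1, 1]
    (by decide +kernel) (by decide +kernel) (by decide +kernel) (by decide +kernel)

theorem gdd_five : Gdd 5 20 :=
  Good.of_development (G := Fin 5) (fun g p => (g + p.1, p.2)) (by decide +kernel)
    ![[(1, 0), (0, 0), (2, 1), (3, 0)], [(2, 1), (0, 0), (4, 2), (3, 2)],
      [(4, 2), (0, 0), (1, 0), (2, 2)], [(1, 2), (2, 2), (3, 1), (0, 0)],
      [(0, 2), (4, 1), (3, 1), (2, 2)], [(1, 1), (0, 0), (3, 1), (4, 1)]]
    (I := Fin 2) ![0, 0, 0, 1, 1, 1]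
    (by decide +kernel) (by decide +kernel) (by decide +kernel) (by decide +kernel)

theorem full_three : Full 3 10 :=
  Full.of_good (X := Fin 2 × Fin 5) (by simp)
    (Good.of_development (G := Fin 5) (fun g p => (p.1, g + p.2)) (by decide +kernel)
      ![[(0, 0), (0, 1), (0, 3), (1, 0)], [(1, 0), (0, 3), (1, 1), (1, 4)],
        [(1, 4), (1, 1), (0, 1), (0, 0)]]
      (I := Fin 1) ![0, 0, 0]
      (by decide +kernel) (by decide +kernel) (by decide +kernel) (by decide +kernel))

theorem full_one : Full 1 1 :=
  Full.of_good (X := Fin 4) (by simp)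
    (Good.of_development (G := Fin 1) (fun _ p => p) (by decide +kernel)
      ![[0, 1, 2, 3], [3, 2, 1, 0]] (I := Fin 1) ![0, 0]
      (by decide +kernel) (by decide +kernel) (by decide +kernel) (by decide +kernel))

theorem full_zero : Full 0 0 :=
  Good.empty (by decide)

theorem gdd_seven : Gdd 7 42 :=
  Gdd.of_translation (ZMod.castHom (by decide : 7 ∣ 21) (ZMod 7)).toAddMonoidHom
    (by decide +kernel) ![[0, 10, 9, 1], [10, 0, 4, 6], [1, 9, 6, 4]]
    (I := Fin 1) ![0, 0, 0]
    (by decide +kernel) (by decide +kernel) (by decide +kernel) (by decide +kernel)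

theorem gdd_nine : Gdd 9 54 :=
  Gdd.of_translation (ZMod.castHom (by decide : 9 ∣ 27) (ZMod 9)).toAddMonoidHom
    (by decide +kernel) ![[0, 1, 3, 7], [4, 15, 1, 0], [0, 5, 25, 15], [13, 5, 0, 21]]
    (I := Fin 2) ![0, 0, 1, 1]
    (by decide +kernel) (by decide +kernel) (by decide +kernel) (by decide +kernel)

theorem gdd_eleven : Gdd 11 99 :=
  Gdd.of_translation (ZMod.castHom (by decide : 11 ∣ 33) (ZMod 11)).toAddMonoidHom
    (by decide +kernel)
    ![[0, 14, 12, 21], [18, 14, 0, 1], [12, 14, 18, 11], [0, 10, 13, 5], [10, 0, 27, 18]]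
    (I := Fin 2) ![0, 0, 0, 1, 1]
    (by decide +kernel) (by decide +kernel) (by decide +kernel) (by decide +kernel)

/-- A truncated transversal design over a ring with lines of slopes `0`, `∞`, `1`, `a`, `b`. -/
theorem Full.of_ring {R : Type*} [CommRing R] [Fintype R] [DecidableEq R] {r h g : ℕ} (a b : R)
    (ha : IsUnit a) (hb : IsUnit b) (ha1 : IsUnit (a - 1)) (hb1 : IsUnit (b - 1))
    (hab : IsUnit (b - a)) (hr : r ≤ Fintype.card R) (hF : Full (Fintype.card R) h)
    (hFr : Full r g) :
    Full (4 * Fintype.card R + r)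
      (12 * Fintype.card R ^ 2 + 8 * r * Fintype.card R + (4 * h + g)) := by
  obtain ⟨J, -, hJ⟩ := Finset.exists_subset_card_eq (s := (Finset.univ : Finset R)) hr
  let u : Fin 5 → R := ![1, 0, 1, 1, 1]
  let w : Fin 5 → R := ![0, 1, 1, a, b]
  have hdet (i j : Fin 5) (hij : i ≠ j) : IsUnit (u i * w j - u j * w i) := by
    have ha1' := ha1.neg
    have hb1' := hb1.neg
    have hab' := hab.neg
    rw [neg_sub] at ha1' hb1' hab'
    fin_cases i <;> fin_cases j <;> first | exact (hij rfl).elim | simp [u, w, *]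
  let M := {p : Fin 5 × R // p.1 = 4 → p.2 ∈ J}
  let L (s : R × R) (i : Fin 5) : R := u i * s.1 + w i * s.2
  let T (s : R × R) : Finset M := Finset.univ.filter fun p => p.1.2 = L s p.1.1
  let q (p : M) : Fin 5 := p.1.1
  have hq (s : R × R) : Set.InjOn q (T s) := by
    rintro ⟨⟨i, x⟩, hx⟩ h1 ⟨⟨j, y⟩, hy⟩ h2 (rfl : i = j)
    simp only [T, Finset.coe_filter, Finset.mem_univ, true_and, Set.mem_ofPred_eq] at h1 h2
    simp [h1, h2]
  have hT (x y : M) (hxy : q x ≠ q y) : ∃! s, x ∈ T s ∧ y ∈ T s := by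
    obtain ⟨⟨i, c⟩, hx⟩ := x
    obtain ⟨⟨j, d⟩, hy⟩ := y
    obtain ⟨e, he⟩ := (hdet i j hxy).exists_left_inv
    simp only [T, L, Finset.mem_filter, Finset.mem_univ, true_and]
    refine ⟨(e * (c * w j - d * w i), e * (u i * d - u j * c)), ⟨?_, ?_⟩, ?_⟩
    · linear_combination (-c) * he
    · linear_combination (-d) * he
    · rintro ⟨s, t⟩ ⟨rfl, rfl⟩
      ext
      · linear_combination (-s) * he
      · linear_combination (-t) * he
  have hcard (s : R × R) : (T s).card = if L s 4 ∈ J then 5 else 4 := by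
    rw [← Finset.card_image_of_injOn (hq s)]
    have : (T s).image q = Finset.univ.filter fun i => i = 4 → L s 4 ∈ J := by
      ext i
      simp only [T, Finset.mem_image, Finset.mem_filter, Finset.mem_univ, true_and]
      constructor
      · rintro ⟨⟨⟨i, x⟩, hx⟩, (rfl : x = L s i), rfl⟩ (rfl : i = 4)
        exact hx rfl
      · intro h
        exact ⟨⟨(i, L s i), fun (hi : i = 4) => hi ▸ h hi⟩, rfl, rfl⟩
    rw [this]
    split_ifs with h
    · simp [h]
    · simp only [h]
      decide
  have hG (s : R × R) : Gdd (T s).card (12 + if L s 4 ∈ J then 8 else 0) := by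
    rw [hcard]
    split_ifs
    · exact gdd_five
    · exact gdd_four
  have hk (k : Fin 5) : Fintype.card {x // q x = k} = if k = 4 then r else Fintype.card R := by
    let e : {x // q x = k} ≃ {x : R // k = 4 → x ∈ J} :=
      { toFun := fun p => ⟨p.1.1.2, fun h => p.1.2 (p.2.trans h)⟩
        invFun := fun x => ⟨⟨(k, x.1), x.2⟩, rfl⟩
        left_inv := by
          rintro ⟨⟨⟨i, x⟩, hx⟩, rfl⟩
          rfl
        right_inv := fun x => rfl }
    rw [Fintype.card_congr e, Fintype.card_subtype]
    split_ifs with h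
    · simp [h, hJ]
    · simp [h]
  have hM : Fintype.card M = 4 * Fintype.card R + r := by
    rw [← Fintype.card_congr (Equiv.sigmaFiberEquiv q), Fintype.card_sigma,
      Finset.sum_congr rfl fun k _ => hk k, Fin.sum_univ_five]
    simp only [Fin.reduceEq, if_false, if_true]
    ring
  have hF' (k : Fin 5) : Full (Fintype.card {x // q x = k}) (if k = 4 then g else h) := by
    rw [hk]
    split_ifs
    · exact hFr
    · exact hF
  have hsum : ∑ s : R × R, (12 + if L s 4 ∈ J then 8 else 0) =
      12 * Fintype.card R ^ 2 + 8 * r * Fintype.card R := by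
    rw [Finset.sum_add_distrib, Fintype.sum_prod_type_right fun s => if L s 4 ∈ J then 8 else 0]
    have (y : R) : (∑ x : R, if L (x, y) 4 ∈ J then 8 else 0) = 8 * r := by
      have h1 := Equiv.sum_comp (Equiv.addRight (b * y)) fun z => if z ∈ J then 8 else 0
      have h2 : (∑ x : R, if x ∈ J then 8 else 0) = 8 * r := by simp [hJ, mul_comm]
      rw [h2] at h1
      convert h1 using 3 with x
      simp [L, u, w]
    simp only [this]
    simp
    ring
  have := Full.of_pbd q T hq hT hG hF'
  rw [hM, hsum, Fin.sum_univ_five] at this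
  convert this using 2
  simp only [Fin.reduceEq, if_false, if_true]
  ring

/-- Blocks of size 4 developed by the translations of a group, with the cosets of the kernel of
`q` as groups. -/
theorem Full.of_translation {G M K : Type*} [AddCommGroup G] [AddCommGroup M] [Fintype G]
    [Fintype M] [DecidableEq G] [DecidableEq M] [Fintype K] {c g : ℕ} (q : G →+ M)
    (hq : ∀ k, Fintype.card {x // q x = k} = c) (base : K → Finset G)
    (hb : ∀ k, (base k).card = 4) (hbq : ∀ k, ∀ x ∈ base k, ∀ y ∈ base k, q x = q y → x = y)
    (hT : ∀ d, q d ≠ 0 → ∃! j : G × K, j.1 ∈ base j.2 ∧ j.1 + d ∈ base j.2) (hc : Full c g) :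
    Full (Fintype.card G) (Fintype.card G * Fintype.card K * 12 + Fintype.card M * g) := by
  have := Full.of_pbd q (fun j : G × K => (base j.2).map (addLeftEmbedding j.1))
    (h := fun _ => 12) (g := fun _ => g) ?_ ?_ (fun j => by simpa [hb] using gdd_four)
    (fun k => by simpa [hq] using hc)
  · simpa using this
  · rintro ⟨z, k⟩ x hx y hy hxy
    simp only [Finset.coe_map, Set.mem_image, Finset.mem_coe, addLeftEmbedding_apply] at hx hy
    obtain ⟨x, hx, rfl⟩ := hx
    obtain ⟨y, hy, rfl⟩ := hy
    rw [hbq k x hx y hy (by simpa using hxy)]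
  · intro x y hxy
    simp only [Finset.mem_map, addLeftEmbedding_apply]
    obtain ⟨⟨z, k⟩, ⟨hz, hz'⟩, hu⟩ := hT (y - x) (by rwa [map_sub, sub_ne_zero, ne_comm])
    refine ⟨(x - z, k), ⟨⟨z, hz, by simp⟩, ⟨_, hz', by dsimp only; abel⟩⟩, ?_⟩
    rintro ⟨z', l⟩ ⟨⟨s, hs, rfl⟩, ⟨t, ht, rfl⟩⟩
    have := hu (s, l) (by simpa using ⟨hs, ht⟩)
    simp only [Prod.mk.injEq] at this
    simp [← this.1, this.2]

theorem full_thirteen : Full 13 169 :=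
  Full.of_translation (AddMonoidHom.id (ZMod 13)) (c := 1) (by decide +kernel)
    (fun _ : Fin 1 => {0, 1, 3, 9}) (by decide +kernel) (by decide +kernel) (by decide +kernel)
    full_one

theorem full_fifteen : Full 15 230 :=
  Full.of_translation (ZMod.castHom (by decide : 5 ∣ 15) (ZMod 5)).toAddMonoidHom (c := 3)
    (by decide +kernel) (fun _ : Fin 1 => {0, 1, 3, 7}) (by decide +kernel) (by decide +kernel)
    (by decide +kernel) full_three

theorem full_twentySeven : Full 27 738 :=
  Full.of_translation (AddMonoidHom.snd (ZMod 3) (ZMod 3 × ZMod 3)) (c := 3)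
    (by decide +kernel)
    ![{(0, 0, 0), (0, 0, 1), (0, 1, 0), (1, 1, 1)}, {(0, 0, 0), (2, 0, 1), (1, 1, 2), (0, 2, 2)}]
    (by decide +kernel) (by decide +kernel) (by decide +kernel) full_three

theorem Gdd.full {m h : ℕ} (hG : Gdd m h) : Full m (h + m) := by
  have := Full.of_pbd (id : Fin m → Fin m) (fun _ : Unit => Finset.univ) (h := fun _ => h)
    (g := fun _ => 1) (fun _ => Set.injOn_id _) (fun _ _ _ => ⟨(), by simp, by simp⟩)
    (fun _ => by simpa using hG) (fun k => by simpa using full_one)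
  simpa using this

/-- Some ring with `n` elements has slopes suitable for `Full.of_ring`. -/
def HasSlopes (n : ℕ) : Prop :=
  ∃ (R : Type) (_ : CommRing R) (_ : Fintype R) (a b : R), Fintype.card R = n ∧ IsUnit a ∧
    IsUnit b ∧ IsUnit (a - 1) ∧ IsUnit (b - 1) ∧ IsUnit (b - a)

theorem HasSlopes.full {n r h g : ℕ} (hn : HasSlopes n) (hr : r ≤ n) (hF : Full n h)
    (hFr : Full r g) : Full (4 * n + r) (12 * n ^ 2 + 8 * r * n + (4 * h + g)) := by
  obtain ⟨R, _, _, a, b, rfl, ha, hb, ha1, hb1, hab⟩ := hn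
  exact Full.of_ring a b ha hb ha1 hb1 hab hr hF hFr

theorem hasSlopes_of_mod {n : ℕ} (hn : n % 6 = 1 ∨ n % 6 = 5) : HasSlopes n := by
  have : NeZero n := ⟨by rintro rfl; simp at hn⟩
  have h2 : IsUnit ((2 : ℕ) : ZMod n) := by
    rw [ZMod.isUnit_iff_coprime, Nat.Prime.coprime_iff_not_dvd Nat.prime_two]
    omega
  have h3 : IsUnit ((3 : ℕ) : ZMod n) := by
    rw [ZMod.isUnit_iff_coprime, Nat.Prime.coprime_iff_not_dvd Nat.prime_three]
    omega
  refine ⟨ZMod n, inferInstance, inferInstance, 2, 3, ZMod.card n, by exact_mod_cast h2,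
    by exact_mod_cast h3, ?_, ?_, ?_⟩
  · norm_num
  · norm_num
    exact_mod_cast h2
  · norm_num

theorem hasSlopes_prime_pow {p k : ℕ} [Fact p.Prime] (hk : 4 ≤ p ^ k) : HasSlopes (p ^ k) := by
  have hk0 : k ≠ 0 := by
    rintro rfl
    simp at hk
  let := Fintype.ofFinite (GaloisField p k)
  have hcard : Fintype.card (GaloisField p k) = p ^ k := by
    rw [← Nat.card_eq_fintype_card, GaloisField.card p k hk0]
  obtain ⟨a, -, ha⟩ := Finset.exists_mem_notMem_of_card_lt_card
    (s := {(0 : GaloisField p k), 1}) (t := Finset.univ)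
    (Finset.card_le_two.trans_lt (by rw [Finset.card_univ]; omega))
  obtain ⟨b, -, hb⟩ := Finset.exists_mem_notMem_of_card_lt_card
    (s := {(0 : GaloisField p k), 1, a}) (t := Finset.univ)
    (Finset.card_le_three.trans_lt (by rw [Finset.card_univ]; omega))
  simp only [Finset.mem_insert, Finset.mem_singleton, not_or] at ha hb
  refine ⟨GaloisField p k, inferInstance, inferInstance, a, b, hcard, ?_⟩
  simp [isUnit_iff_ne_zero, sub_ne_zero, ha, hb]

/-- There is a directed design on `3 * m + 1` points in which every defining set has at least
about half of the blocks. -/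
def Dense (m : ℕ) : Prop :=
  ∃ h, 3 * m ^ 2 ≤ 4 * h ∧ Full m h

theorem HasSlopes.dense {n r : ℕ} (hn : HasSlopes n) (hr : r ≤ n) (hP : Dense n)
    (hPr : Dense r) : Dense (4 * n + r) := by
  obtain ⟨h, hh, hF⟩ := hP
  obtain ⟨g, hg, hFr⟩ := hPr
  exact ⟨_, by nlinarith [Nat.zero_le (r * n)], hn.full hr hF hFr⟩

theorem hasSlopes_four : HasSlopes 4 := hasSlopes_prime_pow (p := 2) (k := 2) (by norm_num)

theorem hasSlopes_nine : HasSlopes 9 := hasSlopes_prime_pow (p := 3) (k := 2) (by norm_num)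

theorem hasSlopes_sixteen : HasSlopes 16 := hasSlopes_prime_pow (p := 2) (k := 4) (by norm_num)

theorem dense_four : Dense 4 := ⟨_, by norm_num, gdd_four.full⟩

theorem dense_sixteen : Dense 16 :=
  hasSlopes_four.dense (r := 0) (by norm_num) dense_four ⟨0, by norm_num, full_zero⟩

theorem dense_of_odd_of_le {r : ℕ} (hr : r % 2 = 1) (hr' : r ≤ 19) : Dense r := by
  have h1 : Dense 1 := ⟨_, by norm_num, full_one⟩
  have h3 : Dense 3 := ⟨_, by norm_num, full_three⟩
  have hr : r = 1 ∨ r = 3 ∨ r = 5 ∨ r = 7 ∨ r = 9 ∨ r = 11 ∨ r = 13 ∨ r = 15 ∨ r = 17 ∨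
    r = 19 := by omega
  rcases hr with rfl | rfl | rfl | rfl | rfl | rfl | rfl | rfl | rfl | rfl
  · exact h1
  · exact h3
  · exact ⟨_, by norm_num, gdd_five.full⟩
  · exact ⟨_, by norm_num, gdd_seven.full⟩
  · exact ⟨_, by norm_num, gdd_nine.full⟩
  · exact ⟨_, by norm_num, gdd_eleven.full⟩
  · exact ⟨_, by norm_num, full_thirteen⟩
  · exact ⟨_, by norm_num, full_fifteen⟩
  · exact hasSlopes_four.dense (r := 1) (by norm_num) dense_four h1
  · exact hasSlopes_four.dense (r := 3) (by norm_num) dense_four h3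

theorem exists_eq_four_mul_add {m : ℕ} (hm : 23 ≤ m) (h27 : m ≠ 27)
    (h : m % 4 = 3 ∨ m % 6 = 1 ∨ m % 6 = 5) :
    ∃ n r, m = 4 * n + r ∧ r ≤ n ∧ r % 2 = 1 ∧ r ≤ 15 ∧
      (n % 6 = 1 ∨ n % 6 = 5 ∨ n = 9 ∨ n = 16) := by
  by_cases h67 : m = 67
  · exact ⟨16, 3, by omega⟩
  by_cases h9 : 37 ≤ m ∧ m ≤ 43
  · exact ⟨9, m - 36, by omega⟩
  have key : ∀ r, r % 2 = 1 → r ≤ 15 → (m % 24 = (r + 4) % 24 ∨ m % 24 = (r + 20) % 24) →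
      5 * r ≤ m → ∃ n r, m = 4 * n + r ∧ r ≤ n ∧ r % 2 = 1 ∧ r ≤ 15 ∧
        (n % 6 = 1 ∨ n % 6 = 5 ∨ n = 9 ∨ n = 16) :=
    fun r _ _ _ _ => ⟨(m - r) / 4, r, by omega⟩
  have hc : m % 24 = 1 ∨ m % 24 = 5 ∨ m % 24 = 13 ∨ m % 24 = 17 ∨ m % 24 = 7 ∨ m % 24 = 11 ∨
    m % 24 = 19 ∨ m % 24 = 23 ∨ m % 24 = 3 ∨ m % 24 = 15 := by omega
  rcases hc with h | h | h | h | h | h | h | h | h | h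
  · exact key 5 (by omega) (by omega) (by omega) (by omega)
  · exact key 1 (by omega) (by omega) (by omega) (by omega)
  · exact key 9 (by omega) (by omega) (by omega) (by omega)
  · exact key 13 (by omega) (by omega) (by omega) (by omega)
  · exact key 3 (by omega) (by omega) (by omega) (by omega)
  · exact key 7 (by omega) (by omega) (by omega) (by omega)
  · exact key 15 (by omega) (by omega) (by omega) (by omega)
  · exact key 3 (by omega) (by omega) (by omega) (by omega)
  · exact key 7 (by omega) (by omega) (by omega) (by omega)
  · exact key 11 (by omega) (by omega) (by omega) (by omega)

theorem hasSlopes_of_mod_or {n : ℕ} (hn : n % 6 = 1 ∨ n % 6 = 5 ∨ n = 9 ∨ n = 16) :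
    HasSlopes n := by
  rcases hn with h | h | rfl | rfl
  exacts [hasSlopes_of_mod (.inl h), hasSlopes_of_mod (.inr h), hasSlopes_nine, hasSlopes_sixteen]

theorem dense_of_mod {m : ℕ} (hm : m % 6 = 1 ∨ m % 6 = 5 ∨ m = 9 ∨ m = 16) : Dense m := by
  induction m using Nat.strong_induction_on with
  | _ m ih =>
    by_cases h16 : m = 16
    · exact h16 ▸ dense_sixteen
    by_cases hlt : m < 23
    · exact dense_of_odd_of_le (by omega) (by omega)
    · obtain ⟨n, r, rfl, hrn, hr, hr', hn⟩ :=
        exists_eq_four_mul_add (m := m) (by omega) (by omega) (by omega)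
      exact (hasSlopes_of_mod_or hn).dense hrn (ih n (by omega) hn)
        (dense_of_odd_of_le hr (by omega))

theorem exists_full {m : ℕ} (hm : 23 ≤ m) (hm' : m % 4 = 3) :
    ∃ h, 15 * m ^ 2 ≤ 16 * h + m ∧ Full m h := by
  by_cases h27 : m = 27
  · subst h27
    exact ⟨_, by norm_num, full_twentySeven⟩
  obtain ⟨n, r, rfl, hrn, hr, hr', hn⟩ := exists_eq_four_mul_add hm h27 (.inl hm')
  obtain ⟨h, hh, hF⟩ := dense_of_mod hn
  obtain ⟨g, hg, hFr⟩ := dense_of_odd_of_le hr (by omega)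
  refine ⟨_, ?_, (hasSlopes_of_mod_or hn).full hrn hF hFr⟩
  nlinarith [Nat.mul_le_mul_left r hrn, Nat.zero_le (r * n)]

end DirectedDesign

/-- For every `v ≥ 70` with `v ≡ 10 (mod 12)` there is a
`2-(v,4,1)DD` (with `v(v-1)/6` blocks) whose every defining set contains at
least `(5/8 - 1/(4v) - 1/(2v))·(v(v-1)/6)` blocks. -/
theorem stmt10 (v : ℕ) (hv : 70 ≤ v) (hmod : v % 12 = 10) :
    ∃ B : Multiset (List (Fin v)),
      IsDD 2 4 1 B ∧
      (Multiset.card B : ℝ) = (v : ℝ) * ((v : ℝ) - 1) / 6 ∧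
      ∀ S : Multiset (List (Fin v)), IsDefiningSet 2 4 1 B S →
        (5 / 8 - 1 / (4 * (v : ℝ)) - 1 / (2 * (v : ℝ)))
            * ((v : ℝ) * ((v : ℝ) - 1) / 6)
          ≤ (Multiset.card S : ℝ) := by
  obtain ⟨m, rfl⟩ : ∃ m, v = 3 * m + 1 := ⟨v / 3, by omega⟩
  obtain ⟨h, hh, hF⟩ := DirectedDesign.exists_full (m := m) (by omega) (by omega)
  obtain ⟨B, hB, hcard, hS⟩ := (hF.good (Fintype.card_fin _)).exists_isDD
  refine ⟨B, hB, ?_, fun S hSB => ?_⟩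
  · rw [Nat.add_sub_cancel] at hcard
    have : (6 : ℝ) * Multiset.card B = (3 * m + 1) * (3 * m) := by exact_mod_cast hcard
    push_cast
    linarith
  · have hhR : (15 : ℝ) * m ^ 2 ≤ 16 * h + m := by exact_mod_cast hh
    have hSR : (h : ℝ) ≤ Multiset.card S := by exact_mod_cast hS S hSB
    refine le_trans ?_ hSR
    have hv0 : (3 * (m : ℝ) + 1) ≠ 0 := by positivity
    push_cast
    calc _ = (15 * (m : ℝ) ^ 2 - m) / 16 := by field_simp; ring
      _ ≤ h := by linarith
end
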